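/- (Lemma 3.2.) If an approximate design P is φ1-universally optimal, then p_s = 0 for every treatment sequence s ∉ T. -/

import Mathlib

open Matrix Finset

noncomputable section

/-- `B^m_{i,j}`: the `i × j` real matrix whose upper-left `m × m` block is
`B_m = I_m − J_m/m` and whose remaining entries are `0`. -/
def Bblock (m i j : ℕ) : Matrix (Fin i) (Fin j) ℝ :=
  Matrix.of fun a b =>
    if (a : ℕ) < m ∧ (b : ℕ) < m then
      (if (a : ℕ) = (b : ℕ) then 1 else 0) - 1 / (m : ℝ)
    else 0

/-- `B_k = I_k − J_k/k`. -/
def Bsq (k : ℕ) : Matrix (Fin k) (Fin k) ℝ := Bblock k k k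

/-- Partial sums `a_{j,k} = ∑_{i=j}^k a_i`. -/
def aInt (a : ℕ → ℝ) (j k : ℕ) : ℝ := ∑ i ∈ Finset.Icc j k, a i

/-- `α_k = n⁻¹((n+1)a_k + a_{1,k−1}^{n+1} − a_{1,k}^{n+1})`. -/
def alphaCoef (n : ℕ) (a : ℕ → ℝ) (k : ℕ) : ℝ :=
  (((n : ℝ) + 1) * a k + (aInt a 1 (k - 1)) ^ (n + 1) - (aInt a 1 k) ^ (n + 1)) / (n : ℝ)

/-- `β_k = a_k + a_{k+1,p} a_{1,k}^n − a_{k,p} a_{1,k−1}^n`. -/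
def betaCoef (p n : ℕ) (a : ℕ → ℝ) (k : ℕ) : ℝ :=
  a k + aInt a (k + 1) p * (aInt a 1 k) ^ n - aInt a k p * (aInt a 1 (k - 1)) ^ n

/-- `A = ∑_{k=1}^p α_k B^k_p`. -/
def Amat (p n : ℕ) (a : ℕ → ℝ) : Matrix (Fin p) (Fin p) ℝ :=
  ∑ k ∈ Finset.Icc 1 p, alphaCoef n a k • Bblock k p p

/-- `B = ∑_{k=1}^p β_k B^k_p`. -/
def Bmat (p n : ℕ) (a : ℕ → ℝ) : Matrix (Fin p) (Fin p) ℝ :=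
  ∑ k ∈ Finset.Icc 1 p, betaCoef p n a k • Bblock k p p


/-- Treatment/period incidence matrix `T_s` of a treatment sequence `s`
(periods are indexed by `Fin p`, treatments by `Fin t`). -/
def Tmat {p t : ℕ} (s : Fin p → Fin t) : Matrix (Fin p) (Fin t) ℝ :=
  Matrix.of fun k i => if s k = i then 1 else 0

/-- Carryover incidence matrix `F_s`: `(F_s)_{k,i} = 1` iff `k ≥ 2` and the
treatment in period `k − 1` is `i`. -/
def Fmat {p t : ℕ} (s : Fin p → Fin t) : Matrix (Fin p) (Fin t) ℝ :=
  Matrix.of fun k i =>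
    if (k : ℕ) = 0 then 0
    else if s ⟨(k : ℕ) - 1, lt_of_le_of_lt (Nat.sub_le _ _) k.isLt⟩ = i then 1 else 0

/-- `T̂_s = T_s B_t`. -/
def That {p t : ℕ} (s : Fin p → Fin t) : Matrix (Fin p) (Fin t) ℝ := Tmat s * Bsq t

/-- `F̂_s = F_s B_t`. -/
def Fhat {p t : ℕ} (s : Fin p → Fin t) : Matrix (Fin p) (Fin t) ℝ := Fmat s * Bsq t

/-- An approximate design: a probability vector indexed by all `t^p` sequences. -/
def IsDesign {p t : ℕ} (P : (Fin p → Fin t) → ℝ) : Prop :=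
  (∀ s, 0 ≤ P s) ∧ ∑ s, P s = 1

/-- A design is symmetric if it is invariant under relabeling of treatments. -/
def IsSymmetricDesign {p t : ℕ} (P : (Fin p → Fin t) → ℝ) : Prop :=
  ∀ (σ : Equiv.Perm (Fin t)) (s : Fin p → Fin t), P (fun k => σ (s k)) = P s

/-- `T̄ = ∑_s p_s T_s`. -/
def Tbar {p t : ℕ} (P : (Fin p → Fin t) → ℝ) : Matrix (Fin p) (Fin t) ℝ :=
  ∑ s, P s • Tmat s

/-- `F̄ = ∑_s p_s F_s`. -/
def Fbar {p t : ℕ} (P : (Fin p → Fin t) → ℝ) : Matrix (Fin p) (Fin t) ℝ :=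
  ∑ s, P s • Fmat s

/-- `C₁₁(P) = n(∑_s p_s T_s' A T_s − T̄' B T̄)`. -/
def C11 (p t n : ℕ) (a : ℕ → ℝ) (P : (Fin p → Fin t) → ℝ) : Matrix (Fin t) (Fin t) ℝ :=
  (n : ℝ) • (∑ s, P s • ((Tmat s)ᵀ * Amat p n a * Tmat s) - (Tbar P)ᵀ * Bmat p n a * Tbar P)

/-- `C₁₂(P) = n(∑_s p_s T_s' A F_s − T̄' B F̄)`. -/
def C12 (p t n : ℕ) (a : ℕ → ℝ) (P : (Fin p → Fin t) → ℝ) : Matrix (Fin t) (Fin t) ℝ :=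
  (n : ℝ) • (∑ s, P s • ((Tmat s)ᵀ * Amat p n a * Fmat s) - (Tbar P)ᵀ * Bmat p n a * Fbar P)

/-- `C₂₂(P) = n(∑_s p_s F_s' A F_s − F̄' B F̄)`. -/
def C22 (p t n : ℕ) (a : ℕ → ℝ) (P : (Fin p → Fin t) → ℝ) : Matrix (Fin t) (Fin t) ℝ :=
  (n : ℝ) • (∑ s, P s • ((Fmat s)ᵀ * Amat p n a * Fmat s) - (Fbar P)ᵀ * Bmat p n a * Fbar P)

/-- `W` is a generalized inverse of `C`. -/
def IsGInv {t : ℕ} (C W : Matrix (Fin t) (Fin t) ℝ) : Prop := C * W * C = C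

/-- The information matrix `C(P) = C₁₁(P) − C₁₂(P) W C₂₁(P)`, computed with a
generalized inverse `W` of `C₂₂(P)` (its value does not depend on the choice). -/
def CInfo (p t n : ℕ) (a : ℕ → ℝ) (P : (Fin p → Fin t) → ℝ)
    (W : Matrix (Fin t) (Fin t) ℝ) : Matrix (Fin t) (Fin t) ℝ :=
  C11 p t n a P - C12 p t n a P * W * (C12 p t n a P)ᵀ

/-- The `t × t` permutation matrix of a permutation `σ` of the treatments. -/
def permMat (t : ℕ) (σ : Equiv.Perm (Fin t)) : Matrix (Fin t) (Fin t) ℝ :=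
  Matrix.of fun i j => if σ j = i then 1 else 0

/-- An optimality criterion: a real-valued function `Φ` on `t × t` real symmetric
matrices which is (C.1) concave, (C.2) invariant under simultaneous permutation of
rows and columns, and (C.3) nondecreasing under positive scaling of a positive
semidefinite matrix. -/
def IsCriterion (t : ℕ) (Φ : Matrix (Fin t) (Fin t) ℝ → ℝ) : Prop :=
  (∀ lam : ℝ, 0 ≤ lam → lam ≤ 1 → ∀ M N : Matrix (Fin t) (Fin t) ℝ,
      M.IsHermitian → N.IsHermitian →
      lam * Φ M + (1 - lam) * Φ N ≤ Φ (lam • M + (1 - lam) • N)) ∧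
  (∀ (σ : Equiv.Perm (Fin t)) (M : Matrix (Fin t) (Fin t) ℝ),
      Φ ((permMat t σ)ᵀ * M * permMat t σ) = Φ M) ∧
  (∀ M : Matrix (Fin t) (Fin t) ℝ, M.PosSemidef →
      ∀ b c : ℝ, 0 < b → b ≤ c → Φ (b • M) ≤ Φ (c • M))

/-- `P` is φ₁-universally optimal: `Φ(C(P)) ≥ Φ(C(Q))` for every design `Q` and
every optimality criterion `Φ`. -/
def IsUnivOptimal (p t n : ℕ) (a : ℕ → ℝ) (P : (Fin p → Fin t) → ℝ) : Prop :=
  ∀ Φ : Matrix (Fin t) (Fin t) ℝ → ℝ, IsCriterion t Φ →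
    ∀ Q : (Fin p → Fin t) → ℝ, IsDesign Q →
      ∀ WP WQ : Matrix (Fin t) (Fin t) ℝ,
        IsGInv (C22 p t n a P) WP → IsGInv (C22 p t n a Q) WQ →
          Φ (CInfo p t n a Q WQ) ≤ Φ (CInfo p t n a P WP)

/-- `q_{s,11} = tr(B_t T_s' A T_s B_t)`. -/
def q11 (p t n : ℕ) (a : ℕ → ℝ) (s : Fin p → Fin t) : ℝ :=
  (Bsq t * (Tmat s)ᵀ * Amat p n a * Tmat s * Bsq t).trace

/-- `q_{s,12} = tr(B_t T_s' A F_s B_t)`. -/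
def q12 (p t n : ℕ) (a : ℕ → ℝ) (s : Fin p → Fin t) : ℝ :=
  (Bsq t * (Tmat s)ᵀ * Amat p n a * Fmat s * Bsq t).trace

/-- `q_{s,22} = tr(B_t F_s' A F_s B_t)`. -/
def q22 (p t n : ℕ) (a : ℕ → ℝ) (s : Fin p → Fin t) : ℝ :=
  (Bsq t * (Fmat s)ᵀ * Amat p n a * Fmat s * Bsq t).trace

/-- The quadratic `q_s(x) = q_{s,11} + 2 q_{s,12} x + q_{s,22} x²`. -/
def qfun (p t n : ℕ) (a : ℕ → ℝ) (s : Fin p → Fin t) (x : ℝ) : ℝ :=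
  q11 p t n a s + 2 * q12 p t n a s * x + q22 p t n a s * x ^ 2

/-- `min_x ∑_s p_s q_s(x)`. -/
def qmin (p t n : ℕ) (a : ℕ → ℝ) (P : (Fin p → Fin t) → ℝ) : ℝ :=
  sInf (Set.range fun x : ℝ => ∑ s, P s * qfun p t n a s x)

/-- `y* = max_P min_x ∑_s p_s q_s(x)`, the maximum over all approximate designs. -/
def ystar (p t n : ℕ) (a : ℕ → ℝ) : ℝ :=
  sSup {y : ℝ | ∃ P : (Fin p → Fin t) → ℝ, IsDesign P ∧ y = qmin p t n a P}



/-! ### Dropout weights -/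

/-- The sequence `a` restricted to `{1, …, p}` is a probability vector. -/
structure IsWeight (p : ℕ) (a : ℕ → ℝ) : Prop where
  nonneg : ∀ k ∈ Finset.Icc 1 p, 0 ≤ a k
  sum_eq : ∑ k ∈ Finset.Icc 1 p, a k = 1

lemma aInt_one_succ (a : ℕ → ℝ) (k : ℕ) : aInt a 1 (k + 1) = aInt a 1 k + a (k + 1) := by
  simp [aInt, Finset.sum_Icc_succ_top]

namespace IsWeight

variable {p : ℕ} {a : ℕ → ℝ}

lemma aInt_nonneg (h : IsWeight p a) {j k : ℕ} (hj : 1 ≤ j) (hk : k ≤ p) : 0 ≤ aInt a j k :=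
  Finset.sum_nonneg fun i hi => h.nonneg i <| by
    simp only [Finset.mem_Icc] at hi ⊢; omega

lemma aInt_add (h : IsWeight p a) {k : ℕ} (hk : k ≤ p) :
    aInt a (k + 1) p = 1 - aInt a 1 k := by
  rw [← h.sum_eq, eq_sub_iff_add_eq, add_comm]
  unfold aInt
  rw [← Finset.sum_union]
  · congr 1
    ext i
    simp only [Finset.mem_union, Finset.mem_Icc]
    omega
  · rw [Finset.disjoint_left]
    intro i
    simp only [Finset.mem_Icc]
    omega

lemma aInt_le_one (h : IsWeight p a) {k : ℕ} (hk : k ≤ p) : aInt a 1 k ≤ 1 := by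
  have := h.aInt_add hk
  have := h.aInt_nonneg (j := k + 1) (by omega) le_rfl
  linarith

lemma aInt_eq_one_of_tail (h : IsWeight p a) {m k : ℕ} (hmk : m ≤ k) (hk : k ≤ p)
    (htail : ∀ i ∈ Finset.Icc (m + 1) p, a i = 0) : aInt a 1 k = 1 := by
  have h1 := h.aInt_add hk
  have h2 : aInt a (k + 1) p = 0 := Finset.sum_eq_zero fun i hi => htail i <| by
    simp only [Finset.mem_Icc] at hi ⊢; omega
  linarith

end IsWeight

lemma pow_succ_sub_le {u v : ℝ} (hu : 0 ≤ u) (huv : u ≤ v) (hv : v ≤ 1) (n : ℕ) :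
    v ^ (n + 1) - u ^ (n + 1) ≤ (n + 1) * (v - u) := by
  induction n with
  | zero => simp
  | succ n ih =>
    have h0 : 0 ≤ v ^ (n + 1) - u ^ (n + 1) := sub_nonneg.2 (pow_le_pow_left₀ hu huv _)
    have h1 : u ^ (n + 1) ≤ 1 := pow_le_one₀ hu (huv.trans hv)
    have h2 : v ^ (n + 1 + 1) - u ^ (n + 1 + 1)
        = v * (v ^ (n + 1) - u ^ (n + 1)) + u ^ (n + 1) * (v - u) := by ring
    have h3 : v * (v ^ (n + 1) - u ^ (n + 1)) ≤ 1 * (v ^ (n + 1) - u ^ (n + 1)) := by gcongr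
    have h4 : u ^ (n + 1) * (v - u) ≤ 1 * (v - u) :=
      mul_le_mul_of_nonneg_right h1 (sub_nonneg.2 huv)
    push_cast
    linarith

lemma pow_succ_sub_lt {u v : ℝ} (hu : 0 ≤ u) (huv : u < v) (hv : v ≤ 1) {n : ℕ} (hn : 1 ≤ n) :
    v ^ (n + 1) - u ^ (n + 1) < (n + 1) * (v - u) := by
  obtain ⟨n, rfl⟩ : ∃ k, n = k + 1 := ⟨n - 1, by omega⟩
  have h0 : 0 ≤ v ^ (n + 1) - u ^ (n + 1) := sub_nonneg.2 (pow_le_pow_left₀ hu huv.le _)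
  have h1 : u ^ (n + 1) < 1 := pow_lt_one₀ hu (huv.trans_le hv) (by omega)
  have h2 : v ^ (n + 1 + 1) - u ^ (n + 1 + 1)
      = v * (v ^ (n + 1) - u ^ (n + 1)) + u ^ (n + 1) * (v - u) := by ring
  have h3 : v * (v ^ (n + 1) - u ^ (n + 1)) ≤ 1 * (v ^ (n + 1) - u ^ (n + 1)) := by gcongr
  have h4 : u ^ (n + 1) * (v - u) < 1 * (v - u) :=
    mul_lt_mul_of_pos_right h1 (sub_pos.2 huv)
  have h5 := pow_succ_sub_le hu huv.le hv n
  push_cast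
  linarith

lemma one_sub_succ_mul_pow_nonneg {x : ℝ} (hx : 0 ≤ x) (m : ℕ) :
    0 ≤ 1 - ((m : ℝ) + 1) * x ^ m + m * x ^ (m + 1) := by
  induction m with
  | zero => simp
  | succ m ih =>
    have h : 0 ≤ ((m : ℝ) + 1) * x ^ m * (1 - x) ^ 2 := by positivity
    push_cast
    calc (0 : ℝ) ≤ _ := add_nonneg ih h
      _ = _ := by ring

section Coefficients

variable {p n : ℕ} {a : ℕ → ℝ}

lemma alphaCoef_nonneg (h : IsWeight p a) {k : ℕ} (hk : k ∈ Finset.Icc 1 p) :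
    0 ≤ alphaCoef n a k := by
  have hak := h.nonneg k hk
  obtain ⟨k, rfl⟩ : ∃ j, k = j + 1 := ⟨k - 1, by simp at hk; omega⟩
  have hkp : k + 1 ≤ p := (Finset.mem_Icc.1 hk).2
  have hs := aInt_one_succ a k
  have := pow_succ_sub_le (h.aInt_nonneg le_rfl (by omega : k ≤ p))
    (by linarith : aInt a 1 k ≤ aInt a 1 (k + 1)) (h.aInt_le_one hkp) n
  refine div_nonneg ?_ n.cast_nonneg
  rw [Nat.add_sub_cancel, (by linarith : a (k + 1) = aInt a 1 (k + 1) - aInt a 1 k)]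
  linarith

lemma alphaCoef_pos (hn : 1 ≤ n) (h : IsWeight p a) {k : ℕ} (hk : k ∈ Finset.Icc 1 p)
    (hak : 0 < a k) : 0 < alphaCoef n a k := by
  obtain ⟨k, rfl⟩ : ∃ j, k = j + 1 := ⟨k - 1, by simp at hk; omega⟩
  have hkp : k + 1 ≤ p := (Finset.mem_Icc.1 hk).2
  have hs := aInt_one_succ a k
  have := pow_succ_sub_lt (h.aInt_nonneg le_rfl (by omega : k ≤ p))
    (by linarith : aInt a 1 k < aInt a 1 (k + 1)) (h.aInt_le_one hkp) hn
  refine div_pos ?_ (by exact_mod_cast hn)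
  rw [Nat.add_sub_cancel, (by linarith : a (k + 1) = aInt a 1 (k + 1) - aInt a 1 k)]
  linarith

lemma betaCoef_succ (h : IsWeight p a) {k : ℕ} (hk : k + 1 ≤ p) :
    betaCoef p n a (k + 1) = a (k + 1) + (1 - aInt a 1 (k + 1)) * (aInt a 1 (k + 1)) ^ n
      - (1 - aInt a 1 k) * (aInt a 1 k) ^ n := by
  rw [betaCoef, h.aInt_add hk, h.aInt_add (by omega : k ≤ p), Nat.add_sub_cancel]

/-- The gap between the cumulative sums of `alphaCoef` and of `betaCoef`, as a function of the
cumulative dropout probability. -/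
def cumGap (n : ℕ) (x : ℝ) : ℝ := ((n + 1) * x - x ^ (n + 1)) / n - x - (1 - x) * x ^ n

lemma cumGap_nonneg (hn : 1 ≤ n) {x : ℝ} (hx : 0 ≤ x) : 0 ≤ cumGap n x := by
  obtain ⟨m, rfl⟩ : ∃ k, n = k + 1 := ⟨n - 1, by omega⟩
  have h := mul_nonneg hx (one_sub_succ_mul_pow_nonneg hx m)
  have h2 : cumGap (m + 1) x = x * (1 - ((m : ℝ) + 1) * x ^ m + m * x ^ (m + 1)) / (m + 1) := by
    unfold cumGap
    push_cast
    field_simp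
    ring
  rw [h2]
  positivity

lemma betaCoef_sub_alphaCoef (hn : 1 ≤ n) (h : IsWeight p a) {k : ℕ} (hk : k + 1 ≤ p) :
    betaCoef p n a (k + 1) - alphaCoef n a (k + 1)
      = cumGap n (aInt a 1 k) - cumGap n (aInt a 1 (k + 1)) := by
  have hn' : (n : ℝ) ≠ 0 := by positivity
  rw [betaCoef_succ h hk, alphaCoef, cumGap, cumGap, Nat.add_sub_cancel, aInt_one_succ]
  field_simp
  ring

lemma alphaCoef_eq_zero_of_tail (h : IsWeight p a) {m : ℕ}
    (htail : ∀ i ∈ Finset.Icc (m + 1) p, a i = 0) {k : ℕ} (hk : k ∈ Finset.Icc (m + 1) p) :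
    alphaCoef n a k = 0 := by
  have hk' := Finset.mem_Icc.1 hk
  rw [alphaCoef, htail k hk, h.aInt_eq_one_of_tail (m := m) (by omega) hk'.2 htail,
    h.aInt_eq_one_of_tail (m := m) (by omega) (by omega) htail]
  simp

lemma betaCoef_eq_zero_of_tail (h : IsWeight p a) {m : ℕ}
    (htail : ∀ i ∈ Finset.Icc (m + 1) p, a i = 0) {k : ℕ} (hk : k ∈ Finset.Icc (m + 1) p) :
    betaCoef p n a k = 0 := by
  have hk' := Finset.mem_Icc.1 hk
  obtain ⟨k, rfl⟩ : ∃ j, k = j + 1 := ⟨k - 1, by omega⟩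
  rw [betaCoef_succ h hk'.2, htail _ hk, h.aInt_eq_one_of_tail (m := m) (by omega) hk'.2 htail,
    h.aInt_eq_one_of_tail (m := m) (by omega) (by omega) htail]
  simp

end Coefficients

/-! ### The centering blocks and the matrices `A` and `B` -/

section Blocks

variable {p : ℕ}

lemma Bblock_mulVec (k : ℕ) (v : Fin p → ℝ) (i : Fin p) :
    (Bblock k p p *ᵥ v) i
      = if (i : ℕ) < k then v i - (∑ j with (j : Fin p).val < k, v j) / k else 0 := by
  simp only [mulVec, dotProduct, Bblock, Matrix.of_apply]
  split_ifs with hi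
  · have : ∀ j : Fin p, (if (i : ℕ) < k ∧ (j : ℕ) < k then
        (if (i : ℕ) = (j : ℕ) then (1 : ℝ) else 0) - 1 / (k : ℝ) else 0) * v j
        = (if i = j then v j else 0) - (if (j : ℕ) < k then v j else 0) / k := by
      intro j
      by_cases hij : i = j
      · subst hij
        simp only [hi, and_self, if_true]
        ring
      · have hij' : (i : ℕ) ≠ j := fun h => hij (Fin.ext h)
        by_cases hj : (j : ℕ) < k <;> simp [hi, hj, hij, hij'] 
        ring
    rw [Finset.sum_congr rfl fun j _ => this j, Finset.sum_sub_distrib, ← Finset.sum_div,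
      Finset.sum_filter]
    simp
  · simp [hi]

lemma Bblock_isSymm (k : ℕ) : (Bblock k p p)ᵀ = Bblock k p p := by
  ext i j
  simp only [Bblock, Matrix.transpose_apply, Matrix.of_apply, and_comm, eq_comm]

lemma Bblock_quad (k : ℕ) (v : Fin p → ℝ) :
    v ⬝ᵥ Bblock k p p *ᵥ v
      = ∑ i with (i : Fin p).val < k, v i ^ 2 - (∑ i with (i : Fin p).val < k, v i) ^ 2 / k := by
  simp only [dotProduct, Bblock_mulVec, mul_ite, mul_zero]
  rw [← Finset.sum_filter]
  simp only [mul_sub, Finset.sum_sub_distrib]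
  rw [← Finset.sum_mul]
  congr 1
  · exact Finset.sum_congr rfl fun i _ => by ring
  · ring

lemma Bblock_quad_le_succ {k : ℕ} (hk : k < p) (v : Fin p → ℝ) :
    v ⬝ᵥ Bblock k p p *ᵥ v ≤ v ⬝ᵥ Bblock (k + 1) p p *ᵥ v := by
  have hins : Finset.univ.filter (fun i : Fin p => i.val < k + 1)
      = insert ⟨k, hk⟩ (Finset.univ.filter fun i : Fin p => i.val < k) := by
    ext i
    simp only [Finset.mem_filter, Finset.mem_univ, true_and, Finset.mem_insert, Fin.ext_iff]
    omega
  rw [Bblock_quad, Bblock_quad, hins, Finset.sum_insert (by simp), Finset.sum_insert (by simp)]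
  rcases Nat.eq_zero_or_pos k with rfl | hpos
  · simp
  · generalize (∑ i with (i : Fin p).val < k, v i) = σ
    have hk0 : (0 : ℝ) < k := by exact_mod_cast hpos
    have h : v ⟨k, hk⟩ ^ 2 - (v ⟨k, hk⟩ + σ) ^ 2 / ((k + 1 : ℕ) : ℝ) + σ ^ 2 / k
        = (k * v ⟨k, hk⟩ - σ) ^ 2 / (k * (k + 1)) := by
      push_cast
      field_simp
      ring
    have h2 : 0 ≤ (k * v ⟨k, hk⟩ - σ) ^ 2 / ((k : ℝ) * (k + 1)) := by positivity
    linarith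

lemma Bblock_quad_mono {j k : ℕ} (hjk : j ≤ k) (hk : k ≤ p) (v : Fin p → ℝ) :
    v ⬝ᵥ Bblock j p p *ᵥ v ≤ v ⬝ᵥ Bblock k p p *ᵥ v := by
  induction k, hjk using Nat.le_induction with
  | base => exact le_rfl
  | succ k _ ih => exact (ih (by omega)).trans (Bblock_quad_le_succ (by omega) v)

lemma Bblock_quad_nonneg {k : ℕ} (hk : k ≤ p) (v : Fin p → ℝ) :
    0 ≤ v ⬝ᵥ Bblock k p p *ᵥ v :=
  le_of_eq_of_le (by simp [Bblock_quad]) (Bblock_quad_mono k.zero_le hk v)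

lemma Bblock_quad_two_pos (hp : 2 ≤ p) {v : Fin p → ℝ}
    (hv : v ⟨0, by omega⟩ ≠ v ⟨1, by omega⟩) : 0 < v ⬝ᵥ Bblock 2 p p *ᵥ v := by
  have hf : Finset.univ.filter (fun i : Fin p => i.val < 2)
      = {⟨0, by omega⟩, ⟨1, by omega⟩} := by
    ext i
    simp only [Finset.mem_filter, Finset.mem_univ, true_and, Finset.mem_insert,
      Finset.mem_singleton, Fin.ext_iff]
    omega
  rw [Bblock_quad, hf, Finset.sum_pair (by simp), Finset.sum_pair (by simp)]
  have := sq_pos_of_ne_zero (sub_ne_zero.2 hv)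
  push_cast
  nlinarith

lemma Bblock_mulVec_one {k : ℕ} (hk : k ≤ p) : Bblock k p p *ᵥ 1 = 0 := by
  ext i
  rw [Bblock_mulVec]
  split_ifs with hi
  · have : (Finset.univ.filter fun j : Fin p => j.val < k).card = k := by
      simp [Fin.card_filter_val_lt, hk]
    have hk0 : (k : ℝ) ≠ 0 := by
      have : 0 < k := by omega
      positivity
    simp [this, hk0]
  · rfl

lemma sum_smul_Bblock_quad (c : ℕ → ℝ) (I : Finset ℕ) (v w : Fin p → ℝ) :
    v ⬝ᵥ (∑ k ∈ I, c k • Bblock k p p) *ᵥ w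
      = ∑ k ∈ I, c k * (v ⬝ᵥ Bblock k p p *ᵥ w) := by
  simp only [Matrix.sum_mulVec, Matrix.smul_mulVec, dotProduct_sum, dotProduct_smul, smul_eq_mul]

variable {n : ℕ} {a : ℕ → ℝ}

lemma Amat_isSymm : (Amat p n a)ᵀ = Amat p n a := by
  simp [Amat, Matrix.transpose_sum, Bblock_isSymm]

lemma Bmat_isSymm : (Bmat p n a)ᵀ = Bmat p n a := by
  simp [Bmat, Matrix.transpose_sum, Bblock_isSymm]

lemma Amat_mulVec_one : Amat p n a *ᵥ 1 = 0 := by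
  rw [Amat, Matrix.sum_mulVec]
  exact Finset.sum_eq_zero fun k hk => by
    rw [Matrix.smul_mulVec, Bblock_mulVec_one (Finset.mem_Icc.1 hk).2, smul_zero]

lemma Bmat_mulVec_one : Bmat p n a *ᵥ 1 = 0 := by
  rw [Bmat, Matrix.sum_mulVec]
  exact Finset.sum_eq_zero fun k hk => by
    rw [Matrix.smul_mulVec, Bblock_mulVec_one (Finset.mem_Icc.1 hk).2, smul_zero]

lemma Amat_quad_nonneg (h : IsWeight p a) (v : Fin p → ℝ) : 0 ≤ v ⬝ᵥ Amat p n a *ᵥ v := by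
  rw [Amat, sum_smul_Bblock_quad]
  exact Finset.sum_nonneg fun k hk =>
    mul_nonneg (alphaCoef_nonneg h hk) (Bblock_quad_nonneg (Finset.mem_Icc.1 hk).2 v)

lemma Amat_quad_pos (hp : 2 ≤ p) (hn : 1 ≤ n) (h : IsWeight p a)
    (hex : ∃ k ∈ Finset.Icc 2 p, 0 < a k) {v : Fin p → ℝ}
    (hv : v ⟨0, by omega⟩ ≠ v ⟨1, by omega⟩) : 0 < v ⬝ᵥ Amat p n a *ᵥ v := by
  obtain ⟨k, hk, hak⟩ := hex
  rw [Finset.mem_Icc] at hk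
  have hk1 : k ∈ Finset.Icc 1 p := Finset.mem_Icc.2 ⟨by omega, hk.2⟩
  rw [Amat, sum_smul_Bblock_quad]
  refine Finset.sum_pos' (fun j hj => mul_nonneg (alphaCoef_nonneg h hj)
    (Bblock_quad_nonneg (Finset.mem_Icc.1 hj).2 v)) ⟨k, hk1, ?_⟩
  exact mul_pos (alphaCoef_pos hn h hk1 hak)
    ((Bblock_quad_two_pos hp hv).trans_le (Bblock_quad_mono hk.1 hk.2 v))

/-- The excess of `B` over `A`. -/
def excess (p n : ℕ) (a : ℕ → ℝ) : Matrix (Fin p) (Fin p) ℝ := Bmat p n a - Amat p n a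

lemma excess_isSymm : (excess p n a)ᵀ = excess p n a := by
  rw [excess, Matrix.transpose_sub, Amat_isSymm, Bmat_isSymm]

lemma excess_quad_nonneg (hn : 1 ≤ n) (h : IsWeight p a) (v : Fin p → ℝ) :
    0 ≤ v ⬝ᵥ excess p n a *ᵥ v := by
  have key : ∀ m ≤ p, cumGap n (aInt a 1 0) * (v ⬝ᵥ Bblock 0 p p *ᵥ v)
      ≤ ∑ k ∈ Finset.Icc 1 m, (betaCoef p n a k - alphaCoef n a k) * (v ⬝ᵥ Bblock k p p *ᵥ v)
      + cumGap n (aInt a 1 m) * (v ⬝ᵥ Bblock m p p *ᵥ v) := by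
    intro m
    induction m with
    | zero => simp
    | succ m ih =>
      intro hm
      have h1 := ih (by omega)
      rw [Finset.sum_Icc_succ_top (by omega), betaCoef_sub_alphaCoef hn h hm]
      have h2 := mul_le_mul_of_nonneg_left (Bblock_quad_le_succ (by omega : m < p) v)
        (cumGap_nonneg hn (h.aInt_nonneg le_rfl (by omega : m ≤ p)))
      linarith
  have h1 := key p le_rfl
  have h2 : cumGap n (aInt a 1 p) = 0 := by
    have : aInt a 1 p = 1 := h.sum_eq
    have hn' : (n : ℝ) ≠ 0 := by positivity
    rw [this, cumGap]
    field_simp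
    simp
  have h3 : v ⬝ᵥ Bblock 0 p p *ᵥ v = 0 := by simp [Bblock_quad]
  rw [h2, h3, mul_zero, zero_mul, add_zero] at h1
  rw [excess, Amat, Bmat, ← Finset.sum_sub_distrib]
  simp only [← sub_smul]
  rwa [sum_smul_Bblock_quad]

section Tail

variable {m : ℕ}

lemma sum_smul_Bblock_mulVec_congr {c : ℕ → ℝ} (hc : ∀ k ∈ Finset.Icc (m + 1) p, c k = 0)
    {v w : Fin p → ℝ} (hvw : ∀ i : Fin p, (i : ℕ) < m → v i = w i) :
    (∑ k ∈ Finset.Icc 1 p, c k • Bblock k p p) *ᵥ v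
      = (∑ k ∈ Finset.Icc 1 p, c k • Bblock k p p) *ᵥ w := by
  rw [Matrix.sum_mulVec, Matrix.sum_mulVec]
  refine Finset.sum_congr rfl fun k hk => ?_
  rw [Matrix.smul_mulVec, Matrix.smul_mulVec]
  by_cases hkm : k ≤ m
  · congr 1
    ext i
    rw [Bblock_mulVec, Bblock_mulVec]
    split_ifs with hi
    · rw [hvw i (by omega)]
      congr 2
      refine Finset.sum_congr rfl fun j hj => hvw j ?_
      have := (Finset.mem_filter.1 hj).2
      omega
    · rfl
  · rw [hc k (Finset.mem_Icc.2 ⟨by omega, (Finset.mem_Icc.1 hk).2⟩), zero_smul, zero_smul]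

lemma Amat_mulVec_congr (h : IsWeight p a) (htail : ∀ i ∈ Finset.Icc (m + 1) p, a i = 0)
    {v w : Fin p → ℝ} (hvw : ∀ i : Fin p, (i : ℕ) < m → v i = w i) :
    Amat p n a *ᵥ v = Amat p n a *ᵥ w :=
  sum_smul_Bblock_mulVec_congr (fun _ => alphaCoef_eq_zero_of_tail h htail) hvw

lemma Bmat_mulVec_congr (h : IsWeight p a) (htail : ∀ i ∈ Finset.Icc (m + 1) p, a i = 0)
    {v w : Fin p → ℝ} (hvw : ∀ i : Fin p, (i : ℕ) < m → v i = w i) :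
    Bmat p n a *ᵥ v = Bmat p n a *ᵥ w :=
  sum_smul_Bblock_mulVec_congr (fun _ => betaCoef_eq_zero_of_tail h htail) hvw

/-- In the last period with a positive dropout weight, only one block of `A` contributes. -/
lemma Amat_mulVec_last (h : IsWeight p a) (htail : ∀ i ∈ Finset.Icc (m + 1) p, a i = 0)
    (hm : 1 ≤ m) (hmp : m ≤ p) (v : Fin p → ℝ) :
    (Amat p n a *ᵥ v) ⟨m - 1, by omega⟩
      = alphaCoef n a m * (v ⟨m - 1, by omega⟩ - (∑ j with (j : Fin p).val < m, v j) / m) := by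
  rw [Amat, Matrix.sum_mulVec, Finset.sum_apply,
    Finset.sum_eq_single_of_mem m (Finset.mem_Icc.2 ⟨hm, hmp⟩)]
  · rw [Matrix.smul_mulVec, Pi.smul_apply, Bblock_mulVec, if_pos (by simp; omega), smul_eq_mul]
  · intro k hk hkm
    rw [Matrix.smul_mulVec, Pi.smul_apply, Bblock_mulVec]
    rcases lt_or_gt_of_ne hkm with hlt | hgt
    · rw [if_neg (by simp; omega), smul_zero]
    · rw [alphaCoef_eq_zero_of_tail h htail
        (Finset.mem_Icc.2 ⟨by omega, (Finset.mem_Icc.1 hk).2⟩), zero_smul]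

end Tail

end Blocks

/-! ### The reduced matrix `B̃` -/

lemma dotProduct_mulVec_comm {ι : Type*} [Fintype ι] {M : Matrix ι ι ℝ} (hM : Mᵀ = M)
    (v w : ι → ℝ) : v ⬝ᵥ M *ᵥ w = w ⬝ᵥ M *ᵥ v := by
  rw [dotProduct_mulVec, ← mulVec_transpose, hM, dotProduct_comm]

section Reduced

variable {p n : ℕ} {a : ℕ → ℝ}

/-- The common value of `F_s 1_t`: zero in the first period and one afterwards. -/
def carryOne (p : ℕ) : Fin p → ℝ := fun k => if (k : ℕ) = 0 then 0 else 1

/-- The image of `carryOne` under `excess`. -/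
def excessVec (p n : ℕ) (a : ℕ → ℝ) : Fin p → ℝ := excess p n a *ᵥ carryOne p

/-- The value of the quadratic form of `excess` at `carryOne`. -/
def excessVal (p n : ℕ) (a : ℕ → ℝ) : ℝ := carryOne p ⬝ᵥ excessVec p n a

/-- `B` with the contribution of the direction `carryOne` to `excess` removed. -/
def Bred (p n : ℕ) (a : ℕ → ℝ) : Matrix (Fin p) (Fin p) ℝ :=
  Bmat p n a - (excessVal p n a)⁻¹ • vecMulVec (excessVec p n a) (excessVec p n a)

lemma dotProduct_Bred_mulVec (v w : Fin p → ℝ) :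
    v ⬝ᵥ Bred p n a *ᵥ w = v ⬝ᵥ Bmat p n a *ᵥ w
      - (excessVal p n a)⁻¹ * ((excessVec p n a ⬝ᵥ v) * (excessVec p n a ⬝ᵥ w)) := by
  rw [Bred, Matrix.sub_mulVec, dotProduct_sub, Matrix.smul_mulVec, dotProduct_smul,
    vecMulVec_mulVec, smul_eq_mul]
  congr 2
  simp [dotProduct_comm v, mul_comm]

lemma Bred_isSymm : (Bred p n a)ᵀ = Bred p n a := by
  rw [Bred, Matrix.transpose_sub, Bmat_isSymm, Matrix.transpose_smul, transpose_vecMulVec]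

lemma excessVec_dotProduct (v : Fin p → ℝ) :
    excessVec p n a ⬝ᵥ v = carryOne p ⬝ᵥ Bmat p n a *ᵥ v - carryOne p ⬝ᵥ Amat p n a *ᵥ v := by
  rw [← dotProduct_sub, ← Matrix.sub_mulVec, ← excess, dotProduct_comm, excessVec,
    dotProduct_mulVec_comm excess_isSymm]

lemma excess_posSemidef (hn : 1 ≤ n) (h : IsWeight p a) : (excess p n a).PosSemidef := by
  refine PosSemidef.of_dotProduct_mulVec_nonneg ?_ fun v => ?_
  · rw [IsHermitian, conjTranspose_eq_transpose_of_trivial, excess_isSymm]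
  · simpa using excess_quad_nonneg hn h v

lemma excessVec_eq_zero (hn : 1 ≤ n) (h : IsWeight p a) (h0 : excessVal p n a = 0) :
    excessVec p n a = 0 := by
  have := (excess_posSemidef (n := n) hn h).dotProduct_mulVec_zero_iff (carryOne p)
  exact this.1 (by rw [star_trivial]; exact h0)

lemma Bred_quad_nonneg (hn : 1 ≤ n) (h : IsWeight p a) (v : Fin p → ℝ) :
    0 ≤ v ⬝ᵥ Bred p n a *ᵥ v := by
  rw [dotProduct_Bred_mulVec]
  have hA := Amat_quad_nonneg (n := n) h v
  have hBA : v ⬝ᵥ Bmat p n a *ᵥ v = v ⬝ᵥ Amat p n a *ᵥ v + v ⬝ᵥ excess p n a *ᵥ v := by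
    rw [excess, Matrix.sub_mulVec, dotProduct_sub]
    ring
  set ρ := excessVal p n a with hρ
  set c := excessVec p n a ⬝ᵥ v with hc
  have hN := excess_quad_nonneg hn h (v - (ρ⁻¹ * c) • carryOne p)
  have h1 : v ⬝ᵥ excess p n a *ᵥ carryOne p = c := by rw [hc, dotProduct_comm]; rfl
  have h2 : carryOne p ⬝ᵥ excess p n a *ᵥ v = c := by
    rw [dotProduct_mulVec_comm excess_isSymm, h1]
  have h3 : carryOne p ⬝ᵥ excess p n a *ᵥ carryOne p = ρ := rfl
  simp only [Matrix.mulVec_sub, Matrix.mulVec_smul, dotProduct_sub, sub_dotProduct,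
    dotProduct_smul, smul_dotProduct, smul_eq_mul, h1, h2, h3] at hN
  by_cases hρ0 : ρ = 0
  · simp only [hρ0, _root_.inv_zero, zero_mul, sub_zero] at hN ⊢
    linarith
  · have h4 : ρ⁻¹ * c * (ρ⁻¹ * c * ρ) = ρ⁻¹ * (c * c) := by field_simp
    linarith

lemma dotProduct_Bred_mulVec_carryOne (hn : 1 ≤ n) (h : IsWeight p a) (v : Fin p → ℝ) :
    v ⬝ᵥ Bred p n a *ᵥ carryOne p = v ⬝ᵥ Amat p n a *ᵥ carryOne p := by
  have h1 : excessVec p n a ⬝ᵥ carryOne p = excessVal p n a := dotProduct_comm _ _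
  have h2 : excessVec p n a ⬝ᵥ v
      = v ⬝ᵥ Bmat p n a *ᵥ carryOne p - v ⬝ᵥ Amat p n a *ᵥ carryOne p := by
    rw [excessVec_dotProduct, dotProduct_mulVec_comm Bmat_isSymm,
      dotProduct_mulVec_comm Amat_isSymm]
  rw [dotProduct_Bred_mulVec, h1]
  by_cases h0 : excessVal p n a = 0
  · have h3 := excessVec_eq_zero hn h h0
    rw [h3, zero_dotProduct] at h2
    rw [h3, zero_dotProduct]
    linarith
  · rw [mul_comm (excessVec p n a ⬝ᵥ v), inv_mul_cancel_left₀ h0]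
    linarith

end Reduced

/-! ### Information blocks of a design -/

section Designs

variable {p t n : ℕ} {a : ℕ → ℝ}

lemma Tmat_mulVec (s : Fin p → Fin t) (v : Fin t → ℝ) : Tmat s *ᵥ v = fun k => v (s k) := by
  ext k
  simp [Tmat, mulVec, dotProduct]

lemma Fmat_mulVec (s : Fin p → Fin t) (v : Fin t → ℝ) :
    Fmat s *ᵥ v = fun k : Fin p => if (k : ℕ) = 0 then 0 else
      v (s ⟨(k : ℕ) - 1, lt_of_le_of_lt (Nat.sub_le _ _) k.isLt⟩) := by
  ext k
  by_cases hk : (k : ℕ) = 0 <;> simp [Fmat, mulVec, dotProduct, hk]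

lemma Tmat_mulVec_one (s : Fin p → Fin t) : Tmat s *ᵥ 1 = 1 := by
  rw [Tmat_mulVec]; rfl

lemma Fmat_mulVec_one (s : Fin p → Fin t) : Fmat s *ᵥ 1 = carryOne p := by
  rw [Fmat_mulVec]; rfl

lemma Tbar_mulVec (P : (Fin p → Fin t) → ℝ) (v : Fin t → ℝ) :
    Tbar P *ᵥ v = ∑ s, P s • (Tmat s *ᵥ v) := by
  simp only [Tbar, Matrix.sum_mulVec, Matrix.smul_mulVec]

lemma Fbar_mulVec (P : (Fin p → Fin t) → ℝ) (v : Fin t → ℝ) :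
    Fbar P *ᵥ v = ∑ s, P s • (Fmat s *ᵥ v) := by
  simp only [Fbar, Matrix.sum_mulVec, Matrix.smul_mulVec]

lemma Tbar_mulVec_one {P : (Fin p → Fin t) → ℝ} (hP : IsDesign P) : Tbar P *ᵥ 1 = 1 := by
  simp only [Tbar_mulVec, Tmat_mulVec_one, ← Finset.sum_smul, hP.2, one_smul]

lemma Fbar_mulVec_one {P : (Fin p → Fin t) → ℝ} (hP : IsDesign P) :
    Fbar P *ᵥ 1 = carryOne p := by
  simp only [Fbar_mulVec, Fmat_mulVec_one, ← Finset.sum_smul, hP.2, one_smul]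

/-- The common shape `n(∑_s p_s X_s' A Y_s − X̄' B Ȳ)` of the information blocks. -/
def infoBlock (n : ℕ) (A B : Matrix (Fin p) (Fin p) ℝ) (P : (Fin p → Fin t) → ℝ)
    (X Y : (Fin p → Fin t) → Matrix (Fin p) (Fin t) ℝ) : Matrix (Fin t) (Fin t) ℝ :=
  (n : ℝ) • (∑ s, P s • ((X s)ᵀ * A * Y s) - (∑ s, P s • X s)ᵀ * B * (∑ s, P s • Y s))

lemma dotProduct_transpose_mul_mulVec (X Y : Matrix (Fin p) (Fin t) ℝ)
    (A : Matrix (Fin p) (Fin p) ℝ) (v w : Fin t → ℝ) :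
    v ⬝ᵥ (Xᵀ * A * Y) *ᵥ w = (X *ᵥ v) ⬝ᵥ A *ᵥ (Y *ᵥ w) := by
  rw [← Matrix.mulVec_mulVec, ← Matrix.mulVec_mulVec, dotProduct_mulVec, vecMul_transpose]

lemma dotProduct_infoBlock_mulVec (A B : Matrix (Fin p) (Fin p) ℝ) (P : (Fin p → Fin t) → ℝ)
    (X Y : (Fin p → Fin t) → Matrix (Fin p) (Fin t) ℝ) (v w : Fin t → ℝ) :
    v ⬝ᵥ infoBlock n A B P X Y *ᵥ w
      = n * (∑ s, P s * ((X s *ᵥ v) ⬝ᵥ A *ᵥ (Y s *ᵥ w))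
        - ((∑ s, P s • X s) *ᵥ v) ⬝ᵥ B *ᵥ ((∑ s, P s • Y s) *ᵥ w)) := by
  simp only [infoBlock, Matrix.smul_mulVec, dotProduct_smul, Matrix.sub_mulVec, dotProduct_sub,
    Matrix.sum_mulVec, dotProduct_sum, dotProduct_transpose_mul_mulVec, smul_eq_mul]

lemma dotProduct_C11_mulVec (P : (Fin p → Fin t) → ℝ) (v w : Fin t → ℝ) :
    v ⬝ᵥ C11 p t n a P *ᵥ w
      = n * (∑ s, P s * ((Tmat s *ᵥ v) ⬝ᵥ Amat p n a *ᵥ (Tmat s *ᵥ w))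
        - (Tbar P *ᵥ v) ⬝ᵥ Bmat p n a *ᵥ (Tbar P *ᵥ w)) :=
  dotProduct_infoBlock_mulVec _ _ _ _ _ _ _

lemma dotProduct_C12_mulVec (P : (Fin p → Fin t) → ℝ) (v w : Fin t → ℝ) :
    v ⬝ᵥ C12 p t n a P *ᵥ w
      = n * (∑ s, P s * ((Tmat s *ᵥ v) ⬝ᵥ Amat p n a *ᵥ (Fmat s *ᵥ w))
        - (Tbar P *ᵥ v) ⬝ᵥ Bmat p n a *ᵥ (Fbar P *ᵥ w)) :=
  dotProduct_infoBlock_mulVec _ _ _ _ _ _ _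

lemma dotProduct_C22_mulVec (P : (Fin p → Fin t) → ℝ) (v w : Fin t → ℝ) :
    v ⬝ᵥ C22 p t n a P *ᵥ w
      = n * (∑ s, P s * ((Fmat s *ᵥ v) ⬝ᵥ Amat p n a *ᵥ (Fmat s *ᵥ w))
        - (Fbar P *ᵥ v) ⬝ᵥ Bmat p n a *ᵥ (Fbar P *ᵥ w)) :=
  dotProduct_infoBlock_mulVec _ _ _ _ _ _ _

/-- The carryover block with `B` replaced by `Bred`. -/
def redC22 (p t n : ℕ) (a : ℕ → ℝ) (P : (Fin p → Fin t) → ℝ) : Matrix (Fin t) (Fin t) ℝ :=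
  infoBlock n (Amat p n a) (Bred p n a) P Fmat Fmat

lemma dotProduct_redC22_mulVec (P : (Fin p → Fin t) → ℝ) (v w : Fin t → ℝ) :
    v ⬝ᵥ redC22 p t n a P *ᵥ w
      = n * (∑ s, P s * ((Fmat s *ᵥ v) ⬝ᵥ Amat p n a *ᵥ (Fmat s *ᵥ w))
        - (Fbar P *ᵥ v) ⬝ᵥ Bred p n a *ᵥ (Fbar P *ᵥ w)) :=
  dotProduct_infoBlock_mulVec _ _ _ _ _ _ _

lemma infoBlock_transpose {A B : Matrix (Fin p) (Fin p) ℝ} (hA : Aᵀ = A) (hB : Bᵀ = B)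
    (P : (Fin p → Fin t) → ℝ) (X : (Fin p → Fin t) → Matrix (Fin p) (Fin t) ℝ) :
    (infoBlock n A B P X X)ᵀ = infoBlock n A B P X X := by
  simp only [infoBlock, Matrix.transpose_smul, Matrix.transpose_sub, Matrix.transpose_sum,
    Matrix.transpose_mul, Matrix.transpose_transpose, hA, hB, Matrix.mul_assoc]

lemma C22_isSymm (P : (Fin p → Fin t) → ℝ) : (C22 p t n a P)ᵀ = C22 p t n a P :=
  infoBlock_transpose Amat_isSymm Bmat_isSymm P Fmat

lemma redC22_isSymm (P : (Fin p → Fin t) → ℝ) : (redC22 p t n a P)ᵀ = redC22 p t n a P :=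
  infoBlock_transpose Amat_isSymm Bred_isSymm P Fmat

lemma sum_mul_dotProduct_left (P : (Fin p → Fin t) → ℝ) (f : (Fin p → Fin t) → Fin p → ℝ)
    (w : Fin p → ℝ) : ∑ s, P s * (f s ⬝ᵥ w) = (∑ s, P s • f s) ⬝ᵥ w := by
  simp only [sum_dotProduct, smul_dotProduct, smul_eq_mul]

lemma dotProduct_C22_mulVec_one {P : (Fin p → Fin t) → ℝ} (hP : IsDesign P) (v : Fin t → ℝ) :
    v ⬝ᵥ C22 p t n a P *ᵥ 1 = -(n * (excessVec p n a ⬝ᵥ Fbar P *ᵥ v)) := by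
  rw [dotProduct_C22_mulVec]
  simp only [Fmat_mulVec_one, Fbar_mulVec_one hP]
  rw [sum_mul_dotProduct_left, ← Fbar_mulVec, excessVec_dotProduct,
    dotProduct_mulVec_comm Bmat_isSymm, dotProduct_mulVec_comm Amat_isSymm]
  ring

lemma dotProduct_C12_mulVec_one {P : (Fin p → Fin t) → ℝ} (hP : IsDesign P) (v : Fin t → ℝ) :
    v ⬝ᵥ C12 p t n a P *ᵥ 1 = -(n * (excessVec p n a ⬝ᵥ Tbar P *ᵥ v)) := by
  rw [dotProduct_C12_mulVec]
  simp only [Fmat_mulVec_one, Fbar_mulVec_one hP]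
  rw [sum_mul_dotProduct_left, ← Tbar_mulVec, excessVec_dotProduct,
    dotProduct_mulVec_comm Bmat_isSymm, dotProduct_mulVec_comm Amat_isSymm]
  ring

lemma dotProduct_redC22_mulVec_one (hn : 1 ≤ n) (h : IsWeight p a) {P : (Fin p → Fin t) → ℝ}
    (hP : IsDesign P) (v : Fin t → ℝ) : v ⬝ᵥ redC22 p t n a P *ᵥ 1 = 0 := by
  rw [dotProduct_redC22_mulVec]
  simp only [Fmat_mulVec_one, Fbar_mulVec_one hP]
  rw [sum_mul_dotProduct_left, ← Fbar_mulVec, dotProduct_Bred_mulVec_carryOne hn h]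
  ring

lemma C12_transpose_mulVec_one {P : (Fin p → Fin t) → ℝ} (hP : IsDesign P) :
    (C12 p t n a P)ᵀ *ᵥ 1 = 0 := by
  refine dotProduct_eq _ _ fun v => ?_
  rw [dotProduct_comm, dotProduct_mulVec, vecMul_transpose, dotProduct_comm,
    dotProduct_C12_mulVec]
  simp only [Tmat_mulVec_one, Tbar_mulVec_one hP, dotProduct_mulVec_comm Bmat_isSymm 1,
    dotProduct_mulVec_comm Amat_isSymm 1, Bmat_mulVec_one, Amat_mulVec_one]
  simp

lemma C11_mulVec_one {P : (Fin p → Fin t) → ℝ} (hP : IsDesign P) :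
    C11 p t n a P *ᵥ 1 = 0 := by
  refine dotProduct_eq _ _ fun v => ?_
  rw [dotProduct_comm, dotProduct_C11_mulVec]
  simp only [Tmat_mulVec_one, Tbar_mulVec_one hP, Bmat_mulVec_one, Amat_mulVec_one]
  simp

lemma CInfo_mulVec_one {P : (Fin p → Fin t) → ℝ} (hP : IsDesign P)
    (W : Matrix (Fin t) (Fin t) ℝ) : CInfo p t n a P W *ᵥ 1 = 0 := by
  rw [CInfo, Matrix.sub_mulVec, C11_mulVec_one hP, ← Matrix.mulVec_mulVec,
    C12_transpose_mulVec_one hP, Matrix.mulVec_zero, sub_zero]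

lemma mul_ginv_mul_of_ker_le {C L W : Matrix (Fin t) (Fin t) ℝ} (hW : IsGInv C W)
    (hker : ∀ u, C *ᵥ u = 0 → L *ᵥ u = 0) : L * W * C = L := by
  refine Matrix.ext_of_mulVec_single fun i => ?_
  have h1 : C *ᵥ (W *ᵥ (C *ᵥ Pi.single i 1) - Pi.single i 1) = 0 := by
    rw [Matrix.mulVec_sub, Matrix.mulVec_mulVec, Matrix.mulVec_mulVec, hW, sub_self]
  have h2 := hker _ h1
  rw [Matrix.mulVec_sub, Matrix.mulVec_mulVec, Matrix.mulVec_mulVec, sub_eq_zero] at h2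
  exact h2

lemma exists_dotProduct_schur {C L W : Matrix (Fin t) (Fin t) ℝ} (hC : Cᵀ = C)
    (hLW : L * W * C = L) (v : Fin t → ℝ) :
    ∃ r, (∀ w, w ⬝ᵥ C *ᵥ r = v ⬝ᵥ L *ᵥ w) ∧ v ⬝ᵥ (L * W * Lᵀ) *ᵥ v = r ⬝ᵥ C *ᵥ r := by
  have hr1 : C *ᵥ (Wᵀ *ᵥ (Lᵀ *ᵥ v)) = Lᵀ *ᵥ v := by
    have h := congrArg Matrix.transpose hLW
    rw [Matrix.transpose_mul, Matrix.transpose_mul, hC] at h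
    rw [Matrix.mulVec_mulVec, Matrix.mulVec_mulVec, Matrix.mul_assoc, h]
  refine ⟨Wᵀ *ᵥ (Lᵀ *ᵥ v), fun w => ?_, ?_⟩
  · rw [hr1, dotProduct_mulVec, vecMul_transpose, dotProduct_comm]
  · rw [hr1, ← Matrix.mulVec_mulVec, dotProduct_mulVec, Matrix.mulVec_mulVec, ← mulVec_transpose,
      Matrix.transpose_mul]

/-- If the reduced carryover block is positive semidefinite, the information matrix is bounded by
the quadratic forms of the individual sequences. -/
lemma dotProduct_CInfo_le (hn : 1 ≤ n) (h : IsWeight p a) {P : (Fin p → Fin t) → ℝ}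
    (hP : IsDesign P) (hK : ∀ u, 0 ≤ u ⬝ᵥ redC22 p t n a P *ᵥ u)
    (hker : ∀ u, C22 p t n a P *ᵥ u = 0 → C12 p t n a P *ᵥ u = 0)
    {W : Matrix (Fin t) (Fin t) ℝ} (hW : IsGInv (C22 p t n a P) W) (v : Fin t → ℝ) (x : ℝ) :
    v ⬝ᵥ CInfo p t n a P W *ᵥ v ≤ n * ∑ s, P s *
      ((Tmat s *ᵥ v + x • Fmat s *ᵥ v) ⬝ᵥ Amat p n a *ᵥ (Tmat s *ᵥ v + x • Fmat s *ᵥ v)) := by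
  obtain ⟨r, hL, hr⟩ := exists_dotProduct_schur (C22_isSymm P) (mul_ginv_mul_of_ker_le hW hker) v
  have hn0 : (n : ℝ) ≠ 0 := by positivity
  have hfg : excessVec p n a ⬝ᵥ Fbar P *ᵥ r = excessVec p n a ⬝ᵥ Tbar P *ᵥ v := by
    have h1 := hL 1
    rw [dotProduct_mulVec_comm (C22_isSymm P), dotProduct_C22_mulVec_one hP,
      dotProduct_C12_mulVec_one hP, neg_inj] at h1
    exact mul_left_cancel₀ hn0 h1
  have hvr := hL v
  have hB := mul_nonneg n.cast_nonneg
    (Bred_quad_nonneg hn h (Tbar P *ᵥ v + x • (Fbar P *ᵥ v)))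
  have hKx := hK (r + x • v)
  have hKsymm : r ⬝ᵥ redC22 p t n a P *ᵥ v = v ⬝ᵥ redC22 p t n a P *ᵥ r :=
    dotProduct_mulVec_comm (redC22_isSymm P) _ _
  have hsum : ∑ s, P s * ((Tmat s *ᵥ v + x • Fmat s *ᵥ v) ⬝ᵥ
      Amat p n a *ᵥ (Tmat s *ᵥ v + x • Fmat s *ᵥ v))
      = ∑ s, P s * ((Tmat s *ᵥ v) ⬝ᵥ Amat p n a *ᵥ (Tmat s *ᵥ v))
      + 2 * x * ∑ s, P s * ((Tmat s *ᵥ v) ⬝ᵥ Amat p n a *ᵥ (Fmat s *ᵥ v))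
      + x ^ 2 * ∑ s, P s * ((Fmat s *ᵥ v) ⬝ᵥ Amat p n a *ᵥ (Fmat s *ᵥ v)) := by
    simp only [Finset.mul_sum, ← Finset.sum_add_distrib]
    refine Finset.sum_congr rfl fun s _ => ?_
    simp only [Matrix.mulVec_add, Matrix.mulVec_smul, dotProduct_add, add_dotProduct,
      dotProduct_smul, smul_dotProduct, smul_eq_mul]
    rw [dotProduct_mulVec_comm Amat_isSymm (Fmat s *ᵥ v) (Tmat s *ᵥ v)]
    ring
  have hBsymm : (Fbar P *ᵥ v) ⬝ᵥ Bmat p n a *ᵥ (Tbar P *ᵥ v)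
      = (Tbar P *ᵥ v) ⬝ᵥ Bmat p n a *ᵥ (Fbar P *ᵥ v) := dotProduct_mulVec_comm Bmat_isSymm _ _
  rw [CInfo, Matrix.sub_mulVec, dotProduct_sub, hr, dotProduct_C11_mulVec,
    dotProduct_C22_mulVec, hsum]
  rw [dotProduct_C22_mulVec, dotProduct_C12_mulVec] at hvr
  rw [Matrix.mulVec_add, dotProduct_add, add_dotProduct, add_dotProduct, Matrix.mulVec_smul,
    dotProduct_smul, dotProduct_smul, smul_dotProduct, smul_dotProduct, hKsymm] at hKx
  rw [Matrix.mulVec_add, dotProduct_add, add_dotProduct, add_dotProduct, Matrix.mulVec_smul,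
    dotProduct_smul, dotProduct_smul, smul_dotProduct, smul_dotProduct] at hB
  simp only [dotProduct_redC22_mulVec, dotProduct_Bred_mulVec, hfg, hBsymm, smul_eq_mul]
    at hKx hB
  have hvr2 := congrArg (fun y => 2 * x * y) hvr
  linarith

end Designs

/-! ### Generalized inverses and the trace criterion -/

section Trace

variable {p t n : ℕ} {a : ℕ → ℝ}

lemma exists_isGInv (C : Matrix (Fin t) (Fin t) ℝ) : ∃ W, IsGInv C W := by
  obtain ⟨g, hg⟩ := C.toLin'.rangeRestrict.exists_rightInverse_of_surjective
    C.toLin'.range_rangeRestrict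
  obtain ⟨h, hh⟩ := g.exists_extend
  refine ⟨LinearMap.toMatrix' h, ?_⟩
  refine Matrix.toLin'.injective (LinearMap.ext fun v => ?_)
  have h1 := LinearMap.congr_fun hh (C.toLin'.rangeRestrict v)
  have h2 := LinearMap.congr_fun hg (C.toLin'.rangeRestrict v)
  have h3 := congrArg Subtype.val h2
  rw [Matrix.toLin'_mul, Matrix.toLin'_mul, Matrix.toLin'_toMatrix']
  simp only [LinearMap.comp_apply, Submodule.subtype_apply, LinearMap.id_apply,
    LinearMap.codRestrict_apply, LinearMap.rangeRestrict] at h1 h3 ⊢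
  rw [h1, h3]

lemma permMat_mul_transpose (σ : Equiv.Perm (Fin t)) : permMat t σ * (permMat t σ)ᵀ = 1 := by
  ext i j
  simp only [Matrix.mul_apply, permMat, Matrix.transpose_apply, Matrix.of_apply, Matrix.one_apply]
  rw [Finset.sum_eq_single (σ.symm i)]
  · simp
  · intro k _ hk
    have : σ k ≠ i := fun h => hk (by simp [← h])
    simp [this]
  · simp

lemma isCriterion_trace : IsCriterion t Matrix.trace := by
  refine ⟨fun l _ _ M N _ _ => ?_, fun σ M => ?_, fun M hM b c _ hbc => ?_⟩
  · simp
  · rw [Matrix.trace_mul_comm, ← Matrix.mul_assoc, permMat_mul_transpose, Matrix.one_mul]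
  · rw [Matrix.trace_smul, Matrix.trace_smul]
    exact mul_le_mul_of_nonneg_right hbc hM.trace_nonneg

/-- Because the defining inequality ranges over all generalized inverses, the existence of a
universally optimal design forces the kernel of `C22` to lie in the kernel of `C12`. -/
lemma IsUnivOptimal.ker_le {P : (Fin p → Fin t) → ℝ} (hopt : IsUnivOptimal p t n a P)
    {Q : (Fin p → Fin t) → ℝ} (hQ : IsDesign Q) {u : Fin t → ℝ}
    (hu : C22 p t n a Q *ᵥ u = 0) : C12 p t n a Q *ᵥ u = 0 := by
  obtain ⟨WP, hWP⟩ := exists_isGInv (C22 p t n a P)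
  obtain ⟨W, hW⟩ := exists_isGInv (C22 p t n a Q)
  set y := C12 p t n a Q *ᵥ u with hy
  have key : ∀ c : ℝ, (CInfo p t n a Q W).trace + c * (y ⬝ᵥ y) ≤ (CInfo p t n a P WP).trace := by
    intro c
    have hW' : IsGInv (C22 p t n a Q) (W - c • vecMulVec u u) := by
      rw [IsGInv, Matrix.mul_sub, Matrix.sub_mul, hW, Matrix.mul_smul, mul_vecMulVec, hu]
      simp
    have h := hopt _ isCriterion_trace Q hQ WP _ hWP hW'
    have h2 : CInfo p t n a Q (W - c • vecMulVec u u)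
        = CInfo p t n a Q W + c • vecMulVec y y := by
      rw [CInfo, CInfo, Matrix.mul_sub, Matrix.sub_mul, Matrix.mul_smul, Matrix.smul_mul,
        mul_vecMulVec, vecMulVec_mul, vecMul_transpose, ← hy]
      abel
    rw [h2, Matrix.trace_add, Matrix.trace_smul, Matrix.trace_vecMulVec, smul_eq_mul] at h
    exact h
  by_contra hne
  have hpos : 0 < y ⬝ᵥ y :=
    lt_of_le_of_ne (Finset.sum_nonneg fun i _ => mul_self_nonneg (y i)) fun h =>
      hne (dotProduct_self_eq_zero.1 h.symm)
  have h := key (((CInfo p t n a P WP).trace - (CInfo p t n a Q W).trace + 1) / (y ⬝ᵥ y))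
  rw [div_mul_cancel₀ _ hpos.ne'] at h
  linarith

/-- The `i`-th column of the centering matrix `B_t`. -/
def centered (i : Fin t) : Fin t → ℝ := fun j => Bsq t j i

lemma Bsq_apply (i j : Fin t) : Bsq t i j = (if i = j then 1 else 0) - 1 / (t : ℝ) := by
  simp [Bsq, Bblock, Fin.ext_iff]

lemma sum_centered (ht : 2 ≤ t) (i : Fin t) : ∑ j, centered i j = 0 := by
  have : (t : ℝ) ≠ 0 := by positivity
  simp [centered, Bsq_apply, this]

lemma trace_Bsq_mul_mul_Bsq (M : Matrix (Fin t) (Fin t) ℝ) :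
    (Bsq t * M * Bsq t).trace = ∑ i, centered i ⬝ᵥ M *ᵥ centered i := by
  simp only [Matrix.trace, Matrix.diag, Matrix.mul_assoc]
  refine Finset.sum_congr rfl fun i _ => ?_
  rw [Matrix.mul_apply]
  refine Finset.sum_congr rfl fun j _ => ?_
  rw [Matrix.mul_apply, centered, Bsq_apply, Bsq_apply]
  congr 1
  simp [eq_comm]

lemma trace_eq_sum_centered {M : Matrix (Fin t) (Fin t) ℝ} (hM : M *ᵥ 1 = 0) (ht : 2 ≤ t) :
    M.trace = ∑ i, centered i ⬝ᵥ M *ᵥ centered i := by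
  have h0 : (t : ℝ) ≠ 0 := by positivity
  have h1 : M * Bsq t = M := by
    ext i j
    have h2 : ∑ k, M i k = 0 := by simpa [mulVec, dotProduct] using congrFun hM i
    simp [Matrix.mul_apply, Bsq_apply, mul_sub, Finset.sum_sub_distrib, ← Finset.sum_mul, h2]
  have h2 : Bsq t * Bsq t = Bsq t := by
    ext i j
    simp [Matrix.mul_apply, Bsq_apply, mul_sub, sub_mul, Finset.sum_sub_distrib, h0]
  rw [← trace_Bsq_mul_mul_Bsq, Matrix.mul_assoc, h1, Matrix.trace_mul_comm, h1]

lemma q11_eq (s : Fin p → Fin t) : q11 p t n a s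
    = ∑ i, (Tmat s *ᵥ centered i) ⬝ᵥ Amat p n a *ᵥ (Tmat s *ᵥ centered i) := by
  simp only [← dotProduct_transpose_mul_mulVec]
  rw [← trace_Bsq_mul_mul_Bsq, q11]
  simp only [Matrix.mul_assoc]

lemma q12_eq (s : Fin p → Fin t) : q12 p t n a s
    = ∑ i, (Tmat s *ᵥ centered i) ⬝ᵥ Amat p n a *ᵥ (Fmat s *ᵥ centered i) := by
  simp only [← dotProduct_transpose_mul_mulVec]
  rw [← trace_Bsq_mul_mul_Bsq, q12]
  simp only [Matrix.mul_assoc]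

lemma q22_eq (s : Fin p → Fin t) : q22 p t n a s
    = ∑ i, (Fmat s *ᵥ centered i) ⬝ᵥ Amat p n a *ᵥ (Fmat s *ᵥ centered i) := by
  simp only [← dotProduct_transpose_mul_mulVec]
  rw [← trace_Bsq_mul_mul_Bsq, q22]
  simp only [Matrix.mul_assoc]

lemma qfun_eq (s : Fin p → Fin t) (x : ℝ) : qfun p t n a s x
    = ∑ i, (Tmat s *ᵥ centered i + x • Fmat s *ᵥ centered i) ⬝ᵥ
        Amat p n a *ᵥ (Tmat s *ᵥ centered i + x • Fmat s *ᵥ centered i) := by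
  rw [qfun, q11_eq, q12_eq, q22_eq, mul_right_comm, Finset.mul_sum, Finset.sum_mul,
    ← Finset.sum_add_distrib, ← Finset.sum_add_distrib]
  refine Finset.sum_congr rfl fun i _ => ?_
  simp only [Matrix.mulVec_add, Matrix.mulVec_smul, dotProduct_add, add_dotProduct,
    dotProduct_smul, smul_dotProduct, smul_eq_mul]
  rw [dotProduct_mulVec_comm Amat_isSymm (Fmat s *ᵥ centered i) (Tmat s *ᵥ centered i)]
  ring

lemma trace_CInfo_le (ht : 2 ≤ t) (hn : 1 ≤ n) (h : IsWeight p a) {P : (Fin p → Fin t) → ℝ}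
    (hP : IsDesign P) (hK : ∀ u, 0 ≤ u ⬝ᵥ redC22 p t n a P *ᵥ u)
    (hker : ∀ u, C22 p t n a P *ᵥ u = 0 → C12 p t n a P *ᵥ u = 0)
    {W : Matrix (Fin t) (Fin t) ℝ} (hW : IsGInv (C22 p t n a P) W) (x : ℝ) :
    (CInfo p t n a P W).trace ≤ n * ∑ s, P s * qfun p t n a s x := by
  rw [trace_eq_sum_centered (CInfo_mulVec_one hP W) ht]
  refine (Finset.sum_le_sum fun i _ =>
    dotProduct_CInfo_le hn h hP hK hker hW (centered i) x).trans_eq ?_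
  rw [← Finset.mul_sum, Finset.sum_comm]
  simp only [qfun_eq, Finset.mul_sum]

lemma q22_pos (hp : 2 ≤ p) (ht : 2 ≤ t) (hn : 1 ≤ n) (h : IsWeight p a)
    (hex : ∃ k ∈ Finset.Icc 2 p, 0 < a k) (s : Fin p → Fin t) : 0 < q22 p t n a s := by
  rw [q22_eq]
  refine Finset.sum_pos' (fun i _ => Amat_quad_nonneg h _)
    ⟨s ⟨0, by omega⟩, Finset.mem_univ _, Amat_quad_pos hp hn h hex ?_⟩
  have ht' : (2 : ℝ) ≤ t := by exact_mod_cast ht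
  have : (1 : ℝ) / t < 1 := by
    rw [div_lt_one (by linarith)]
    linarith
  simp only [Fmat_mulVec, centered, Bsq_apply]
  simp
  simp at this
  exact fun h => this.ne (by linarith)

end Trace

/-! ### Symmetric designs -/

section Symmetric

variable {p t n : ℕ} {a : ℕ → ℝ}

lemma IsDesign.mix {P Q : (Fin p → Fin t) → ℝ} (hP : IsDesign P) (hQ : IsDesign Q) {ε : ℝ}
    (hε : ε ∈ Set.Icc (0 : ℝ) 1) : IsDesign ((1 - ε) • P + ε • Q) := by
  refine ⟨fun s => ?_, ?_⟩
  · exact add_nonneg (mul_nonneg (sub_nonneg.2 hε.2) (hP.1 s)) (mul_nonneg hε.1 (hQ.1 s))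
  · simp [Finset.sum_add_distrib, ← Finset.mul_sum, hP.2, hQ.2]

lemma IsDesign.sum_mul_pos {P f : (Fin p → Fin t) → ℝ} (hP : IsDesign P) (hf : ∀ s, 0 < f s) :
    0 < ∑ s, P s * f s := by
  refine Finset.sum_pos' (fun s _ => mul_nonneg (hP.1 s) (hf s).le) ?_
  by_contra! h
  have h0 : ∀ s, P s = 0 := fun s =>
    le_antisymm (not_lt.1 fun hs => (h s (Finset.mem_univ s)).not_gt (mul_pos hs (hf s))) (hP.1 s)
  simpa [h0] using hP.2

lemma sum_relabel {M : Type*} [AddCommMonoid M] (σ : Equiv.Perm (Fin t))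
    (f : (Fin p → Fin t) → M) : ∑ s : Fin p → Fin t, f (fun k => σ (s k)) = ∑ s, f s :=
  (Equiv.piCongrRight fun _ : Fin p => σ).sum_comp f

lemma Tmat_relabel (σ : Equiv.Perm (Fin t)) (s : Fin p → Fin t) (v : Fin t → ℝ) :
    Tmat (fun k => σ (s k)) *ᵥ v = Tmat s *ᵥ (v ∘ σ) := by
  simp only [Tmat_mulVec, Function.comp_apply]

lemma Fmat_relabel (σ : Equiv.Perm (Fin t)) (s : Fin p → Fin t) (v : Fin t → ℝ) :
    Fmat (fun k => σ (s k)) *ᵥ v = Fmat s *ᵥ (v ∘ σ) := by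
  simp only [Fmat_mulVec, Function.comp_apply]

lemma mulVec_eq_zero_of_comp {M : Matrix (Fin p) (Fin t) ℝ}
    (hM : ∀ (σ : Equiv.Perm (Fin t)) v, M *ᵥ (v ∘ σ) = M *ᵥ v) {v : Fin t → ℝ}
    (hv : ∑ i, v i = 0) : M *ᵥ v = 0 := by
  have h1 : ∀ k i j, M k i = M k j := by
    intro k i j
    have h := congrFun (hM (Equiv.swap i j) (Pi.single j 1)) k
    have h2 : (Pi.single j (1 : ℝ) : Fin t → ℝ) ∘ Equiv.swap i j = Pi.single i 1 := by
      ext l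
      simp [Pi.single_apply, Equiv.swap_apply_eq_iff]
    rw [h2] at h
    simpa using h
  ext k
  rcases isEmpty_or_nonempty (Fin t) with h | ⟨⟨i⟩⟩
  · simp [mulVec, dotProduct]
  · simp only [mulVec, dotProduct, h1 k _ i, ← Finset.mul_sum, hv, mul_zero, Pi.zero_apply]

namespace IsSymmetricDesign

variable {P : (Fin p → Fin t) → ℝ}

lemma Tbar_comp (hs : IsSymmetricDesign P) (σ : Equiv.Perm (Fin t)) (v : Fin t → ℝ) :
    Tbar P *ᵥ (v ∘ σ) = Tbar P *ᵥ v := by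
  rw [Tbar_mulVec, Tbar_mulVec, ← sum_relabel σ fun s => P s • (Tmat s *ᵥ v)]
  simp only [Tmat_relabel, hs σ]

lemma Fbar_comp (hs : IsSymmetricDesign P) (σ : Equiv.Perm (Fin t)) (v : Fin t → ℝ) :
    Fbar P *ᵥ (v ∘ σ) = Fbar P *ᵥ v := by
  rw [Fbar_mulVec, Fbar_mulVec, ← sum_relabel σ fun s => P s • (Fmat s *ᵥ v)]
  simp only [Fmat_relabel, hs σ]

lemma Tbar_mulVec_eq_zero (hs : IsSymmetricDesign P) {v : Fin t → ℝ} (hv : ∑ i, v i = 0) :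
    Tbar P *ᵥ v = 0 :=
  mulVec_eq_zero_of_comp hs.Tbar_comp hv

lemma Fbar_mulVec_eq_zero (hs : IsSymmetricDesign P) {v : Fin t → ℝ} (hv : ∑ i, v i = 0) :
    Fbar P *ᵥ v = 0 :=
  mulVec_eq_zero_of_comp hs.Fbar_comp hv

lemma dotProduct_C12_comp (hs : IsSymmetricDesign P) (σ : Equiv.Perm (Fin t))
    (v w : Fin t → ℝ) :
    (v ∘ σ) ⬝ᵥ C12 p t n a P *ᵥ (w ∘ σ) = v ⬝ᵥ C12 p t n a P *ᵥ w := by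
  rw [dotProduct_C12_mulVec, dotProduct_C12_mulVec, hs.Tbar_comp, hs.Fbar_comp,
    ← sum_relabel σ fun s => P s * ((Tmat s *ᵥ v) ⬝ᵥ Amat p n a *ᵥ (Fmat s *ᵥ w))]
  simp only [Tmat_relabel, Fmat_relabel, hs σ]

lemma dotProduct_C22_comp (hs : IsSymmetricDesign P) (σ : Equiv.Perm (Fin t))
    (v w : Fin t → ℝ) :
    (v ∘ σ) ⬝ᵥ C22 p t n a P *ᵥ (w ∘ σ) = v ⬝ᵥ C22 p t n a P *ᵥ w := by
  rw [dotProduct_C22_mulVec, dotProduct_C22_mulVec, hs.Fbar_comp, hs.Fbar_comp,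
    ← sum_relabel σ fun s => P s * ((Fmat s *ᵥ v) ⬝ᵥ Amat p n a *ᵥ (Fmat s *ᵥ w))]
  simp only [Fmat_relabel, hs σ]

end IsSymmetricDesign

/-- A bilinear form invariant under relabeling acts as a scalar on vectors with zero sum. -/
lemma exists_mulVec_eq_smul (ht : 2 ≤ t) {M : Matrix (Fin t) (Fin t) ℝ}
    (hM : ∀ (σ : Equiv.Perm (Fin t)) v w, (v ∘ σ) ⬝ᵥ M *ᵥ (w ∘ σ) = v ⬝ᵥ M *ᵥ w) :
    ∃ c : ℝ, ∀ v : Fin t → ℝ, ∑ i, v i = 0 → M *ᵥ v = c • v ∧ Mᵀ *ᵥ v = c • v := by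
  have hσ : ∀ (σ : Equiv.Perm (Fin t)) i j, M (σ i) (σ j) = M i j := by
    intro σ i j
    have h := hM σ (Pi.single (σ i) 1) (Pi.single (σ j) 1)
    have h2 : ∀ k, (Pi.single (σ k) (1 : ℝ) : Fin t → ℝ) ∘ σ = Pi.single k 1 := by
      intro k
      ext l
      simp [Pi.single_apply]
    rw [h2, h2] at h
    simpa using h.symm
  set i₀ : Fin t := ⟨0, by omega⟩
  set i₁ : Fin t := ⟨1, by omega⟩
  have h01 : i₀ ≠ i₁ := by simp [i₀, i₁]
  have hd : ∀ i, M i i = M i₀ i₀ := fun i => by simpa using (hσ (Equiv.swap i i₀) i i).symm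
  have ho : ∀ i j, i ≠ j → M i j = M i₀ i₁ := by
    have h0 : ∀ j, j ≠ i₀ → M i₀ j = M i₀ i₁ := by
      intro j hj
      have h := hσ (Equiv.swap j i₁) i₀ j
      rw [Equiv.swap_apply_left, Equiv.swap_apply_of_ne_of_ne hj.symm h01] at h
      exact h.symm
    intro i j hij
    by_cases hi : i = i₀
    · subst hi
      exact h0 j hij.symm
    · have h1 := hσ (Equiv.swap j i₀) i j
      rw [Equiv.swap_apply_left, Equiv.swap_apply_of_ne_of_ne hij hi] at h1
      have h2 := hσ (Equiv.swap i i₀) i i₀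
      rw [Equiv.swap_apply_left, Equiv.swap_apply_right] at h2
      rw [← h1, ← h2, h0 i hi]
  have hMij : ∀ i j, M i j = M i₀ i₁ + if i = j then M i₀ i₀ - M i₀ i₁ else 0 := by
    intro i j
    split_ifs with hij
    · rw [hij, hd]
      ring
    · rw [ho i j hij, add_zero]
  refine ⟨M i₀ i₀ - M i₀ i₁, fun v hv => ⟨?_, ?_⟩⟩
  · ext i
    simp only [mulVec, dotProduct, hMij i]
    simp [add_mul, Finset.sum_add_distrib, ← Finset.mul_sum, hv]
  · ext i
    simp only [mulVec, dotProduct, Matrix.transpose_apply, hMij _ i]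
    simp [add_mul, Finset.sum_add_distrib, ← Finset.mul_sum, hv]

/-- The design giving equal weight to all sequences. -/
def uniformDesign (p t : ℕ) : (Fin p → Fin t) → ℝ :=
  fun _ => (Fintype.card (Fin p → Fin t) : ℝ)⁻¹

lemma uniformDesign_pos (s : Fin p → Fin t) : 0 < uniformDesign p t s := by
  have : Nonempty (Fin p → Fin t) := ⟨s⟩
  exact inv_pos.2 (by exact_mod_cast Fintype.card_pos)

lemma isDesign_uniformDesign (ht : 2 ≤ t) : IsDesign (uniformDesign p t) := by
  have : Nonempty (Fin p → Fin t) := ⟨fun _ => ⟨0, by omega⟩⟩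
  refine ⟨fun s => (uniformDesign_pos s).le, ?_⟩
  have : (Fintype.card (Fin p → Fin t) : ℝ) ≠ 0 := by exact_mod_cast Fintype.card_ne_zero
  simp only [uniformDesign, Finset.sum_const, nsmul_eq_mul, Finset.card_univ]
  exact mul_inv_cancel₀ this

lemma isSymmetricDesign_uniformDesign : IsSymmetricDesign (uniformDesign p t) :=
  fun _ _ => rfl

end Symmetric

/-! ### A crossing argument -/

section Crossing

variable {p t n : ℕ} {a : ℕ → ℝ}

lemma dotProduct_mulVec_sub_smul_one {K : Matrix (Fin t) (Fin t) ℝ} (hK : Kᵀ = K)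
    (hK1 : K *ᵥ 1 = 0) (v : Fin t → ℝ) (c : ℝ) :
    (v - c • 1) ⬝ᵥ K *ᵥ (v - c • 1) = v ⬝ᵥ K *ᵥ v := by
  rw [Matrix.mulVec_sub, Matrix.mulVec_smul, hK1, smul_zero, sub_zero,
    dotProduct_mulVec_comm hK, Matrix.mulVec_sub, Matrix.mulVec_smul, hK1, smul_zero, sub_zero]

lemma sum_sub_mean (ht : t ≠ 0) (v : Fin t → ℝ) :
    ∑ i, (v - ((∑ i, v i) / t) • (1 : Fin t → ℝ)) i = 0 := by
  have h : (t : ℝ) ≠ 0 := by exact_mod_cast ht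
  simp only [Pi.sub_apply, Pi.smul_apply, Pi.one_apply, smul_eq_mul, mul_one,
    Finset.sum_sub_distrib, Finset.sum_const, Finset.card_univ, Fintype.card_fin, nsmul_eq_mul]
  field_simp
  ring

/-- Along a continuous path of symmetric matrices annihilating `1`, from a matrix with a negative
direction to one which is positive definite on `1^⊥`, the kernel becomes larger at some point. -/
lemma exists_ker_of_path (ht : t ≠ 0) {K : ℝ → Matrix (Fin t) (Fin t) ℝ} (hc : Continuous K)
    (hsymm : ∀ ε, (K ε)ᵀ = K ε) (hK1 : ∀ ε ∈ Set.Icc (0 : ℝ) 1, K ε *ᵥ 1 = 0)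
    (hpos : ∀ u : Fin t → ℝ, ∑ i, u i = 0 → u ≠ 0 → 0 < u ⬝ᵥ K 1 *ᵥ u)
    {u₀ : Fin t → ℝ} (hu₀ : u₀ ⬝ᵥ K 0 *ᵥ u₀ < 0) :
    ∃ ε ∈ Set.Ioo (0 : ℝ) 1, ∃ u : Fin t → ℝ, ∑ i, u i = 0 ∧ u ≠ 0 ∧ K ε *ᵥ u = 0 := by
  set S : Set (ℝ × (Fin t → ℝ)) := {z | z ∈ Set.Icc (0 : ℝ) 1 ×ˢ Metric.sphere 0 1 ∧
    ∑ i, z.2 i = 0 ∧ z.2 ⬝ᵥ K z.1 *ᵥ z.2 ≤ 0} with hS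
  have hform : Continuous fun z : ℝ × (Fin t → ℝ) => z.2 ⬝ᵥ K z.1 *ᵥ z.2 :=
    continuous_snd.dotProduct ((hc.comp continuous_fst).matrix_mulVec continuous_snd)
  have hScomp : IsCompact S := by
    refine (isCompact_Icc.prod (isCompact_sphere _ _)).inter_right ?_
    exact (isClosed_eq (by fun_prop) continuous_const).inter (isClosed_le hform continuous_const)
  have hmem : ∀ ε ∈ Set.Icc (0 : ℝ) 1, ∀ v : Fin t → ℝ, ∑ i, v i = 0 → v ≠ 0 →
      v ⬝ᵥ K ε *ᵥ v ≤ 0 → (ε, ‖v‖⁻¹ • v) ∈ S := by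
    intro ε hε v hv hv0 hle
    refine ⟨⟨hε, ?_⟩, ?_, ?_⟩
    · simp [norm_smul, hv0]
    · simp [← Finset.mul_sum, hv]
    · simp only [Matrix.mulVec_smul, dotProduct_smul, smul_dotProduct, smul_eq_mul]
      have : 0 ≤ ‖v‖⁻¹ := by positivity
      exact mul_nonpos_of_nonneg_of_nonpos this (mul_nonpos_of_nonneg_of_nonpos this hle)
  have h0 : (0 : ℝ) ∈ Set.Icc (0 : ℝ) 1 := by simp
  have hne : S.Nonempty := by
    refine ⟨_, hmem 0 h0 _ (sum_sub_mean ht u₀) (fun h => ?_) ?_⟩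
    · have h2 := dotProduct_mulVec_sub_smul_one (hsymm 0) (hK1 0 h0) u₀ ((∑ i, u₀ i) / t)
      rw [h, zero_dotProduct] at h2
      exact hu₀.ne h2.symm
    · rw [dotProduct_mulVec_sub_smul_one (hsymm 0) (hK1 0 h0)]
      exact hu₀.le
  obtain ⟨⟨ε, u⟩, ⟨⟨hε, hu⟩, hu1, hle⟩, hmax⟩ :=
    hScomp.exists_isMaxOn hne continuous_fst.continuousOn
  simp only at hε hu hu1 hle
  have hu0 : u ≠ 0 := by
    rintro rfl
    simp at hu
  have hε1 : ε < 1 := lt_of_le_of_ne hε.2 fun h => by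
    subst h
    exact (hpos u hu1 hu0).not_ge hle
  have hgt : ∀ ε' ∈ Set.Ioo ε 1, ∀ v, 0 ≤ v ⬝ᵥ K ε' *ᵥ v := by
    intro ε' hε' v
    have h1 : ε' ∈ Set.Icc (0 : ℝ) 1 := ⟨hε.1.trans hε'.1.le, hε'.2.le⟩
    rw [← dotProduct_mulVec_sub_smul_one (hsymm ε') (hK1 ε' h1) v ((∑ i, v i) / t)]
    set w := v - ((∑ i, v i) / t) • (1 : Fin t → ℝ)
    by_contra! hlt
    have hw0 : w ≠ 0 := fun h => by
      rw [h, zero_dotProduct] at hlt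
      exact lt_irrefl _ hlt
    exact (not_le.2 hε'.1) (hmax (hmem ε' h1 w (sum_sub_mean ht v) hw0 hlt.le))
  have hnonneg : ∀ v, 0 ≤ v ⬝ᵥ K ε *ᵥ v := by
    intro v
    have hcont : Continuous fun x => v ⬝ᵥ K x *ᵥ v :=
      continuous_const.dotProduct (hc.matrix_mulVec continuous_const)
    refine ge_of_tendsto ((hcont.tendsto ε).mono_left (nhdsWithin_le_nhds (s := Set.Ioi ε))) ?_
    filter_upwards [Ioo_mem_nhdsGT hε1] with x hx using hgt x hx v
  have hpsd : (K ε).PosSemidef := by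
    refine PosSemidef.of_dotProduct_mulVec_nonneg ?_ fun v => ?_
    · rw [IsHermitian, conjTranspose_eq_transpose_of_trivial, hsymm]
    · simpa using hnonneg v
  refine ⟨ε, ⟨lt_of_le_of_ne hε.1 fun h => ?_, hε1⟩, u, hu1, hu0, ?_⟩
  · subst h
    exact (hnonneg u₀).not_gt hu₀
  · refine (hpsd.dotProduct_mulVec_zero_iff u).1 ?_
    rw [star_trivial]
    exact le_antisymm hle (hnonneg u)

lemma continuous_redC22 : Continuous (redC22 p t n a) := by
  unfold redC22 infoBlock
  fun_prop

end Crossing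

/-! ### Positivity of the reduced carryover block -/

section Reduction

variable {p t n m : ℕ} {a : ℕ → ℝ}

lemma dotProduct_redC22_eq (P : (Fin p → Fin t) → ℝ) (v w : Fin t → ℝ) :
    v ⬝ᵥ redC22 p t n a P *ᵥ w = v ⬝ᵥ C22 p t n a P *ᵥ w
      + n * ((excessVal p n a)⁻¹ * ((excessVec p n a ⬝ᵥ Fbar P *ᵥ v)
        * (excessVec p n a ⬝ᵥ Fbar P *ᵥ w))) := by
  rw [dotProduct_redC22_mulVec, dotProduct_C22_mulVec, dotProduct_Bred_mulVec]
  ring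

lemma exists_C22_mulVec_eq_zero {P : (Fin p → Fin t) → ℝ} (hP : IsDesign P) {u : Fin t → ℝ}
    (hu : redC22 p t n a P *ᵥ u = 0) :
    ∃ c : ℝ, C22 p t n a P *ᵥ (u + c • (1 : Fin t → ℝ)) = 0 := by
  refine ⟨-((excessVal p n a)⁻¹ * (excessVec p n a ⬝ᵥ Fbar P *ᵥ u)),
    dotProduct_eq _ _ fun v => ?_⟩
  have h := dotProduct_redC22_eq (n := n) (a := a) P v u
  rw [hu, dotProduct_zero] at h
  rw [dotProduct_comm, Matrix.mulVec_add, Matrix.mulVec_smul, dotProduct_add, dotProduct_smul,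
    dotProduct_C22_mulVec_one hP, zero_dotProduct, smul_eq_mul]
  linarith

lemma dotProduct_mulVec_congr {M : Matrix (Fin p) (Fin p) ℝ} (hM : Mᵀ = M)
    (hc : ∀ v w : Fin p → ℝ, (∀ i : Fin p, (i : ℕ) < m → v i = w i) → M *ᵥ v = M *ᵥ w)
    {v v' w w' : Fin p → ℝ} (hv : ∀ i : Fin p, (i : ℕ) < m → v i = v' i)
    (hw : ∀ i : Fin p, (i : ℕ) < m → w i = w' i) :
    v ⬝ᵥ M *ᵥ w = v' ⬝ᵥ M *ᵥ w' := by
  rw [hc w w' hw, dotProduct_mulVec_comm hM, hc v v' hv, dotProduct_mulVec_comm hM]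

lemma sum_transfer_smul {M : Type*} [AddCommGroup M] [Module ℝ M] (Q : (Fin p → Fin t) → ℝ)
    (δ : ℝ) (s₁ s₂ : Fin p → Fin t) (f : (Fin p → Fin t) → M) :
    ∑ s, (Q + δ • (Pi.single s₂ 1 - Pi.single s₁ 1) : (Fin p → Fin t) → ℝ) s • f s
      = ∑ s, Q s • f s + δ • (f s₂ - f s₁) := by
  simp only [Pi.add_apply, Pi.smul_apply, Pi.sub_apply, add_smul, Finset.sum_add_distrib,
    smul_assoc, sub_smul, ← Finset.smul_sum, Finset.sum_sub_distrib]
  simp [Pi.single_apply, ite_smul]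

lemma isDesign_transfer {Q : (Fin p → Fin t) → ℝ} (hQ : IsDesign Q) {s₁ s₂ : Fin p → Fin t}
    (hs : s₂ ≠ s₁) : IsDesign (Q + Q s₁ • (Pi.single s₂ 1 - Pi.single s₁ 1)) := by
  refine ⟨fun s => ?_, ?_⟩
  · have h1 := hQ.1 s
    have h2 := hQ.1 s₁
    simp only [Pi.add_apply, Pi.smul_apply, Pi.sub_apply, Pi.single_apply, smul_eq_mul]
    by_cases hs1 : s = s₁
    · subst hs1
      simp [hs.symm]
    · simp only [hs1, if_false, sub_zero]
      split_ifs <;> linarith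
  · have h := sum_transfer_smul Q (Q s₁) s₁ s₂ fun _ => (1 : ℝ)
    simpa [hQ.2] using h

/-- Changing the treatment of the last effective period shows that the corresponding row of
`A F_s u` does not depend on `s` if `u` lies in the kernel of `C22`. -/
lemma Amat_mulVec_Fmat_mulVec_last (hn : 1 ≤ n) (h : IsWeight p a) (ht : 2 ≤ t)
    (htail : ∀ i ∈ Finset.Icc (m + 1) p, a i = 0) (hm : 1 ≤ m) (hmp : m ≤ p)
    (hker : ∀ Q : (Fin p → Fin t) → ℝ, IsDesign Q → ∀ u,
      C22 p t n a Q *ᵥ u = 0 → C12 p t n a Q *ᵥ u = 0)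
    {Q : (Fin p → Fin t) → ℝ} (hQ : IsDesign Q) {u : Fin t → ℝ} (hu : C22 p t n a Q *ᵥ u = 0)
    {s : Fin p → Fin t} (hs : 0 < Q s) :
    (Amat p n a *ᵥ (Fmat s *ᵥ u)) ⟨m - 1, by omega⟩
      = (Bmat p n a *ᵥ (Fbar Q *ᵥ u)) ⟨m - 1, by omega⟩ := by
  have : Nontrivial (Fin t) := Fin.nontrivial_iff_two_le.2 ht
  set k₀ : Fin p := ⟨m - 1, by omega⟩ with hk₀
  obtain ⟨j, hj⟩ := exists_ne (s k₀)
  set s₂ := Function.update s k₀ j with hs₂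
  have hs₂k : s₂ k₀ = j := by simp [hs₂]
  have hne : s₂ ≠ s := fun h => hj (by rw [← hs₂k, h])
  set Q' : (Fin p → Fin t) → ℝ := Q + Q s • (Pi.single s₂ 1 - Pi.single s 1) with hQ'
  have hQ'd : IsDesign Q' := isDesign_transfer hQ hne
  have hF : ∀ v, ∀ i : Fin p, (i : ℕ) < m → (Fmat s₂ *ᵥ v) i = (Fmat s *ᵥ v) i := by
    intro v i hi
    simp only [Fmat_mulVec]
    split_ifs with h0
    · rfl
    · rw [hs₂, Function.update_of_ne]
      simp only [hk₀, ne_eq, Fin.mk.injEq]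
      omega
  have hFbar : ∀ v, ∀ i : Fin p, (i : ℕ) < m → (Fbar Q' *ᵥ v) i = (Fbar Q *ᵥ v) i := by
    intro v i hi
    rw [Fbar_mulVec, Fbar_mulVec, sum_transfer_smul]
    simp [hF v i hi]
  have hAc := fun v w hvw => Amat_mulVec_congr (n := n) h htail (v := v) (w := w) hvw
  have hBc := fun v w hvw => Bmat_mulVec_congr (n := n) h htail (v := v) (w := w) hvw
  have hC22 : C22 p t n a Q' *ᵥ u = 0 := by
    rw [← hu]
    refine dotProduct_eq _ _ fun v => ?_
    rw [dotProduct_comm, dotProduct_comm _ v, dotProduct_C22_mulVec, dotProduct_C22_mulVec,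
      dotProduct_mulVec_congr Bmat_isSymm hBc (hFbar v) (hFbar u)]
    have := sum_transfer_smul Q (Q s) s s₂
      fun s => (Fmat s *ᵥ v) ⬝ᵥ Amat p n a *ᵥ (Fmat s *ᵥ u)
    rw [dotProduct_mulVec_congr Amat_isSymm hAc (hF v) (hF u), sub_self, smul_zero,
      add_zero] at this
    simp only [smul_eq_mul] at this
    rw [this]
  have h1 := congrArg (fun y => Pi.single j 1 ⬝ᵥ y) (hker Q hQ u hu)
  have h2 := congrArg (fun y => Pi.single j 1 ⬝ᵥ y) (hker Q' hQ'd u hC22)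
  simp only [dotProduct_zero, dotProduct_C12_mulVec] at h1 h2
  have hT : Tmat s₂ *ᵥ Pi.single j 1 - Tmat s *ᵥ Pi.single j 1 = (Pi.single k₀ 1 : Fin p → ℝ) := by
    ext k
    simp only [Tmat_mulVec, Pi.sub_apply, Pi.single_apply]
    by_cases hk : k = k₀
    · subst hk
      simp [hs₂k, hj.symm]
    · simp [hs₂, hk]
  have h3 := sum_transfer_smul Q (Q s) s s₂
      fun s => (Tmat s *ᵥ Pi.single j 1) ⬝ᵥ Amat p n a *ᵥ (Fmat s *ᵥ u)
  rw [hAc _ _ (hF u), ← sub_dotProduct, hT] at h3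
  simp only [smul_eq_mul] at h3
  have h4 := sum_transfer_smul Q (Q s) s s₂ fun s => Tmat s *ᵥ Pi.single j (1 : ℝ)
  rw [hT, ← Tbar_mulVec, ← Tbar_mulVec] at h4
  rw [h3, h4, hBc _ _ (hFbar u), add_dotProduct, smul_dotProduct] at h2
  simp only [single_dotProduct, one_mul, smul_eq_mul] at h2
  have hn0 : (n : ℝ) ≠ 0 := by positivity
  have h5 := (mul_eq_zero.1 h1).resolve_left hn0
  have h6 := (mul_eq_zero.1 h2).resolve_left hn0
  have h7 : Q s * ((Amat p n a *ᵥ (Fmat s *ᵥ u)) k₀ - (Bmat p n a *ᵥ (Fbar Q *ᵥ u)) k₀) = 0 := by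
    linarith
  exact sub_eq_zero.1 ((mul_eq_zero.1 h7).resolve_left hs.ne')

lemma exists_last (h : IsWeight p a) (hex : ∃ k ∈ Finset.Icc 2 p, 0 < a k) :
    ∃ m, 2 ≤ m ∧ m ≤ p ∧ 0 < a m ∧ ∀ i ∈ Finset.Icc (m + 1) p, a i = 0 := by
  obtain ⟨k, hk, hak⟩ := hex
  have hne : ((Finset.Icc 2 p).filter fun k => 0 < a k).Nonempty :=
    ⟨k, Finset.mem_filter.2 ⟨hk, hak⟩⟩
  have hmem := Finset.mem_filter.1 (Finset.max'_mem _ hne)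
  rw [Finset.mem_Icc] at hmem
  refine ⟨_, hmem.1.1, hmem.1.2, hmem.2, fun i hi => ?_⟩
  rw [Finset.mem_Icc] at hi
  by_contra h0
  have hai : 0 < a i :=
    lt_of_le_of_ne (h.nonneg i (Finset.mem_Icc.2 ⟨by omega, hi.2⟩)) (Ne.symm h0)
  have hmem' : i ∈ (Finset.Icc 2 p).filter fun k => 0 < a k :=
    Finset.mem_filter.2 ⟨Finset.mem_Icc.2 ⟨by omega, hi.2⟩, hai⟩
  have := Finset.le_max' _ i hmem'
  omega

lemma Amat_mulVec_carryOne_last (hn : 1 ≤ n) (h : IsWeight p a)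
    (htail : ∀ i ∈ Finset.Icc (m + 1) p, a i = 0) (hm : 2 ≤ m) (hmp : m ≤ p) (ham : 0 < a m) :
    (Amat p n a *ᵥ carryOne p) ⟨m - 1, by omega⟩ ≠ 0 := by
  rw [Amat_mulVec_last h htail (by omega) hmp]
  refine mul_ne_zero (alphaCoef_pos hn h (Finset.mem_Icc.2 ⟨by omega, hmp⟩) ham).ne' ?_
  have h1 : carryOne p ⟨m - 1, by omega⟩ = 1 := by
    simp only [carryOne]
    rw [if_neg (by omega)]
  have h2 : ∑ j with (j : Fin p).val < m, carryOne p j < m := by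
    have hcard : (Finset.univ.filter fun j : Fin p => j.val < m).card = m := by
      simp [Fin.card_filter_val_lt, hmp]
    calc ∑ j with (j : Fin p).val < m, carryOne p j
        < ∑ j with (j : Fin p).val < m, (1 : ℝ) := by
          refine Finset.sum_lt_sum (fun j _ => ?_) ⟨⟨0, by omega⟩, ?_, ?_⟩
          · unfold carryOne
            split_ifs <;> norm_num
          · simp; omega
          · simp [carryOne]
      _ = m := by simp [hcard]
  have hm0 : (0 : ℝ) < m := by positivity
  have h3 : (∑ j with (j : Fin p).val < m, carryOne p j) / m < 1 := (div_lt_one hm0).2 h2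
  rw [h1]
  exact (sub_pos.2 h3).ne'

lemma eq_zero_of_redC22_mulVec_eq_zero (hn : 1 ≤ n) (h : IsWeight p a) (ht : 2 ≤ t)
    (hex : ∃ k ∈ Finset.Icc 2 p, 0 < a k)
    (hker : ∀ Q : (Fin p → Fin t) → ℝ, IsDesign Q → ∀ u,
      C22 p t n a Q *ᵥ u = 0 → C12 p t n a Q *ᵥ u = 0)
    {Q : (Fin p → Fin t) → ℝ} (hQ : IsDesign Q) (hQpos : ∀ s, 0 < Q s) {u : Fin t → ℝ}
    (hu1 : ∑ i, u i = 0) (hu : redC22 p t n a Q *ᵥ u = 0) : u = 0 := by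
  obtain ⟨m, hm, hmp, ham, htail⟩ := exists_last h hex
  obtain ⟨c, hc⟩ := exists_C22_mulVec_eq_zero hQ hu
  have hrow := fun i : Fin t => Amat_mulVec_Fmat_mulVec_last hn h ht htail (by omega) hmp hker hQ hc
    (hQpos fun _ => i)
  have hconst : ∀ i, Fmat (fun _ : Fin p => i) *ᵥ (u + c • (1 : Fin t → ℝ))
      = (u i + c) • carryOne p := by
    intro i
    ext k
    simp [Fmat_mulVec, carryOne]
  have hA := Amat_mulVec_carryOne_last hn h htail hm hmp ham
  have heq : ∀ i j, u i = u j := by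
    intro i j
    have h1 := (hrow i).trans (hrow j).symm
    rw [hconst, hconst, Matrix.mulVec_smul, Matrix.mulVec_smul, Pi.smul_apply, Pi.smul_apply,
      smul_eq_mul, smul_eq_mul] at h1
    linarith [mul_right_cancel₀ hA h1]
  ext i
  have h2 : ∑ j, u j = t * u i := by simp [heq _ i]
  rw [hu1] at h2
  have ht0 : (t : ℝ) ≠ 0 := by positivity
  exact (mul_eq_zero.1 h2.symm).resolve_left ht0

lemma redC22_uniformDesign_pos (hp : 2 ≤ p) (hn : 1 ≤ n) (h : IsWeight p a)
    (hex : ∃ k ∈ Finset.Icc 2 p, 0 < a k) {u : Fin t → ℝ} (hu1 : ∑ i, u i = 0) (hu : u ≠ 0) :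
    0 < u ⬝ᵥ redC22 p t n a (uniformDesign p t) *ᵥ u := by
  rw [dotProduct_redC22_mulVec, isSymmetricDesign_uniformDesign.Fbar_mulVec_eq_zero hu1,
    zero_dotProduct, sub_zero]
  obtain ⟨i, hi⟩ := Function.ne_iff.1 hu
  have hn0 : (0 : ℝ) < n := by positivity
  refine mul_pos hn0 (Finset.sum_pos' (fun s _ => ?_) ⟨fun _ => i, Finset.mem_univ _, ?_⟩)
  · exact mul_nonneg (uniformDesign_pos s).le (Amat_quad_nonneg h _)
  · refine mul_pos (uniformDesign_pos _) (Amat_quad_pos hp hn h hex ?_)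
    simpa [Fmat_mulVec] using hi.symm

/-- If the kernel of `C22` is contained in that of `C12` for every design, the reduced carryover
block is positive semidefinite for every design. -/
lemma redC22_quad_nonneg (hp : 2 ≤ p) (hn : 1 ≤ n) (h : IsWeight p a) (ht : 2 ≤ t)
    (hex : ∃ k ∈ Finset.Icc 2 p, 0 < a k)
    (hker : ∀ Q : (Fin p → Fin t) → ℝ, IsDesign Q → ∀ u,
      C22 p t n a Q *ᵥ u = 0 → C12 p t n a Q *ᵥ u = 0)
    {P : (Fin p → Fin t) → ℝ} (hP : IsDesign P) (u : Fin t → ℝ) :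
    0 ≤ u ⬝ᵥ redC22 p t n a P *ᵥ u := by
  by_contra! hlt
  set D : ℝ → (Fin p → Fin t) → ℝ := fun ε => (1 - ε) • P + ε • uniformDesign p t with hD
  have hU : IsDesign (uniformDesign p t) := isDesign_uniformDesign ht
  have hDd : ∀ ε ∈ Set.Icc (0 : ℝ) 1, IsDesign (D ε) := fun ε hε => hP.mix hU hε
  have hDc : Continuous D := by fun_prop
  obtain ⟨ε, hε, v, hv1, hv0, hv⟩ := exists_ker_of_path (by omega)
    (K := fun ε => redC22 p t n a (D ε)) (continuous_redC22.comp hDc) (fun ε => redC22_isSymm _)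
    (fun ε hε => dotProduct_eq _ _ fun v => by
      rw [dotProduct_comm, dotProduct_redC22_mulVec_one hn h (hDd ε hε), zero_dotProduct])
    (fun v hv1 hv0 => by simpa [hD] using redC22_uniformDesign_pos hp hn h hex hv1 hv0)
    (u₀ := u) (by simpa [hD] using hlt)
  refine hv0 (eq_zero_of_redC22_mulVec_eq_zero hn h ht hex hker (hDd ε ⟨hε.1.le, hε.2.le⟩)
    (fun s => ?_) hv1 hv)
  exact add_pos_of_nonneg_of_pos (mul_nonneg (sub_nonneg.2 hε.2.le) (hP.1 s))
    (mul_pos hε.1 (uniformDesign_pos s))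

end Reduction

/-! ### Symmetrization -/

section Symmetrization

variable {p t n : ℕ} {a : ℕ → ℝ}

/-- The average of a design over all relabelings of the treatments. -/
def symmetrize (P : (Fin p → Fin t) → ℝ) : (Fin p → Fin t) → ℝ :=
  fun s => (Fintype.card (Equiv.Perm (Fin t)) : ℝ)⁻¹ *
    ∑ σ : Equiv.Perm (Fin t), P fun k => σ (s k)

lemma isSymmetricDesign_symmetrize (P : (Fin p → Fin t) → ℝ) :
    IsSymmetricDesign (symmetrize P) := fun τ s =>
  congrArg ((Fintype.card (Equiv.Perm (Fin t)) : ℝ)⁻¹ * ·)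
    (Equiv.sum_comp (Equiv.mulRight τ) fun σ : Equiv.Perm (Fin t) => P fun k => σ (s k))

lemma sum_symmetrize_mul (P : (Fin p → Fin t) → ℝ) {f : (Fin p → Fin t) → ℝ}
    (hf : ∀ (σ : Equiv.Perm (Fin t)) s, f (fun k => σ (s k)) = f s) :
    ∑ s, symmetrize P s * f s = ∑ s, P s * f s := by
  have h1 : ∀ σ : Equiv.Perm (Fin t),
      ∑ s : Fin p → Fin t, P (fun k => σ (s k)) * f s = ∑ s, P s * f s := by
    intro σ
    rw [← sum_relabel σ fun s => P s * f s]
    simp only [hf]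
  have hc : (Fintype.card (Equiv.Perm (Fin t)) : ℝ) ≠ 0 := by
    exact_mod_cast Fintype.card_ne_zero
  simp only [symmetrize, mul_assoc, Finset.sum_mul]
  rw [← Finset.mul_sum, Finset.sum_comm]
  simp only [h1, Finset.sum_const, Finset.card_univ, nsmul_eq_mul]
  exact inv_mul_cancel_left₀ hc _

lemma isDesign_symmetrize {P : (Fin p → Fin t) → ℝ} (hP : IsDesign P) :
    IsDesign (symmetrize P) := by
  refine ⟨fun s => mul_nonneg (by positivity) (Finset.sum_nonneg fun σ _ => hP.1 _), ?_⟩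
  have h := sum_symmetrize_mul P (f := fun _ => 1) fun _ _ => rfl
  simpa [hP.2] using h

lemma centered_comp (σ : Equiv.Perm (Fin t)) (i : Fin t) :
    centered i ∘ σ = centered (σ.symm i) := by
  ext j
  simp [centered, Bsq_apply, Equiv.eq_symm_apply]

lemma qfun_relabel (σ : Equiv.Perm (Fin t)) (s : Fin p → Fin t) (x : ℝ) :
    qfun p t n a (fun k => σ (s k)) x = qfun p t n a s x := by
  rw [qfun_eq, qfun_eq]
  simp only [Tmat_relabel, Fmat_relabel, centered_comp]
  exact Equiv.sum_comp σ.symm fun i => (Tmat s *ᵥ centered i + x • Fmat s *ᵥ centered i) ⬝ᵥ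
    Amat p n a *ᵥ (Tmat s *ᵥ centered i + x • Fmat s *ᵥ centered i)

namespace IsSymmetricDesign

variable {Q : (Fin p → Fin t) → ℝ}

lemma sum_centered_C11 (ht : 2 ≤ t) (hs : IsSymmetricDesign Q) :
    ∑ i, centered i ⬝ᵥ C11 p t n a Q *ᵥ centered i = n * ∑ s, Q s * q11 p t n a s := by
  simp only [dotProduct_C11_mulVec, hs.Tbar_mulVec_eq_zero (sum_centered ht _), zero_dotProduct,
    sub_zero, ← Finset.mul_sum, q11_eq]
  rw [Finset.sum_comm]
  simp only [Finset.mul_sum]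

lemma sum_centered_C12 (ht : 2 ≤ t) (hs : IsSymmetricDesign Q) :
    ∑ i, centered i ⬝ᵥ C12 p t n a Q *ᵥ centered i = n * ∑ s, Q s * q12 p t n a s := by
  simp only [dotProduct_C12_mulVec, hs.Tbar_mulVec_eq_zero (sum_centered ht _), zero_dotProduct,
    sub_zero, ← Finset.mul_sum, q12_eq]
  rw [Finset.sum_comm]
  simp only [Finset.mul_sum]

lemma sum_centered_C22 (ht : 2 ≤ t) (hs : IsSymmetricDesign Q) :
    ∑ i, centered i ⬝ᵥ C22 p t n a Q *ᵥ centered i = n * ∑ s, Q s * q22 p t n a s := by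
  simp only [dotProduct_C22_mulVec, hs.Fbar_mulVec_eq_zero (sum_centered ht _), zero_dotProduct,
    sub_zero, ← Finset.mul_sum, q22_eq]
  rw [Finset.sum_comm]
  simp only [Finset.mul_sum]

/-- For a symmetric design, the trace of the information matrix is a value of the averaged
quadratic. -/
lemma exists_trace_CInfo_eq (hp : 2 ≤ p) (ht : 2 ≤ t) (hn : 1 ≤ n) (h : IsWeight p a)
    (hex : ∃ k ∈ Finset.Icc 2 p, 0 < a k) (hs : IsSymmetricDesign Q) (hQ : IsDesign Q)
    {W : Matrix (Fin t) (Fin t) ℝ} (hW : IsGInv (C22 p t n a Q) W) :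
    ∃ x, (CInfo p t n a Q W).trace = n * ∑ s, Q s * qfun p t n a s x := by
  obtain ⟨l, hl⟩ := exists_mulVec_eq_smul ht (hs.dotProduct_C12_comp (n := n) (a := a))
  obtain ⟨c, hc⟩ := exists_mulVec_eq_smul ht (hs.dotProduct_C22_comp (n := n) (a := a))
  have hn0 : (0 : ℝ) < n := by positivity
  have hc0 : c ≠ 0 := by
    rintro rfl
    have h1 := hs.sum_centered_C22 (n := n) (a := a) ht
    simp only [(hc _ (sum_centered ht _)).1, zero_smul, dotProduct_zero,
      Finset.sum_const_zero] at h1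
    exact (mul_pos hn0 (hQ.sum_mul_pos (q22_pos hp ht hn h hex))).ne h1
  refine ⟨-(l / c), ?_⟩
  have key : ∀ v : Fin t → ℝ, ∑ i, v i = 0 → v ⬝ᵥ CInfo p t n a Q W *ᵥ v
      = v ⬝ᵥ C11 p t n a Q *ᵥ v + 2 * (v ⬝ᵥ C12 p t n a Q *ᵥ v) * -(l / c)
        + (v ⬝ᵥ C22 p t n a Q *ᵥ v) * (-(l / c)) ^ 2 := by
    intro v hv
    obtain ⟨hl1, hl2⟩ := hl v hv
    obtain ⟨hc1, hc2⟩ := hc v hv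
    have hv1 : v ⬝ᵥ (C12 p t n a Q * W * (C12 p t n a Q)ᵀ) *ᵥ v = l * (l * (v ⬝ᵥ W *ᵥ v)) := by
      rw [← Matrix.mulVec_mulVec, hl2, ← Matrix.mulVec_mulVec, dotProduct_mulVec,
        ← mulVec_transpose, hl2, Matrix.mulVec_smul, smul_dotProduct, dotProduct_smul]
      rfl
    have hv2 : c * (c * (v ⬝ᵥ W *ᵥ v)) = c * (v ⬝ᵥ v) := by
      have h1 : v ⬝ᵥ (C22 p t n a Q * W * C22 p t n a Q) *ᵥ v = c * (c * (v ⬝ᵥ W *ᵥ v)) := by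
        rw [← Matrix.mulVec_mulVec, hc1, ← Matrix.mulVec_mulVec, dotProduct_mulVec,
          ← mulVec_transpose, hc2, Matrix.mulVec_smul, smul_dotProduct, dotProduct_smul]
        rfl
      rw [← h1, hW, hc1, dotProduct_smul, smul_eq_mul]
    have hv3 := mul_left_cancel₀ hc0 hv2
    rw [CInfo, Matrix.sub_mulVec, dotProduct_sub, hv1, hl1, hc1, dotProduct_smul, dotProduct_smul,
      smul_eq_mul, smul_eq_mul, ← hv3]
    field_simp
    ring
  rw [trace_eq_sum_centered (CInfo_mulVec_one hQ W) ht,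
    Finset.sum_congr rfl fun i _ => key _ (sum_centered ht i), Finset.sum_add_distrib,
    Finset.sum_add_distrib, ← Finset.sum_mul, ← Finset.sum_mul, ← Finset.mul_sum,
    hs.sum_centered_C11 ht, hs.sum_centered_C12 ht, hs.sum_centered_C22 ht]
  simp only [qfun, mul_add, Finset.sum_add_distrib]
  simp only [Finset.mul_sum, Finset.sum_mul]
  simp only [mul_assoc, mul_left_comm]

end IsSymmetricDesign

end Symmetrization

/-! ### The minimax value `y*` -/

section Minimax

variable {p t n : ℕ} {a : ℕ → ℝ}

lemma sum_mul_qfun (P : (Fin p → Fin t) → ℝ) (x : ℝ) : ∑ s, P s * qfun p t n a s x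
    = ∑ s, P s * q11 p t n a s + 2 * (∑ s, P s * q12 p t n a s) * x
      + (∑ s, P s * q22 p t n a s) * x ^ 2 := by
  simp only [Finset.mul_sum, Finset.sum_mul, ← Finset.sum_add_distrib]
  refine Finset.sum_congr rfl fun s _ => ?_
  rw [qfun]
  ring

lemma quadratic_min_le {A B C : ℝ} (hC : 0 < C) (x : ℝ) :
    A + 2 * B * -(B / C) + C * (-(B / C)) ^ 2 ≤ A + 2 * B * x + C * x ^ 2 := by
  have h : A + 2 * B * x + C * x ^ 2 - (A + 2 * B * -(B / C) + C * (-(B / C)) ^ 2)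
      = C * (x + B / C) ^ 2 := by
    field_simp
    ring
  have : 0 ≤ C * (x + B / C) ^ 2 := by positivity
  linarith

lemma IsDesign.exists_isLeast (hp : 2 ≤ p) (ht : 2 ≤ t) (hn : 1 ≤ n) (h : IsWeight p a)
    (hex : ∃ k ∈ Finset.Icc 2 p, 0 < a k) {P : (Fin p → Fin t) → ℝ} (hP : IsDesign P) :
    ∃ x, ∀ y, ∑ s, P s * qfun p t n a s x ≤ ∑ s, P s * qfun p t n a s y := by
  refine ⟨-((∑ s, P s * q12 p t n a s) / ∑ s, P s * q22 p t n a s), fun y => ?_⟩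
  rw [sum_mul_qfun, sum_mul_qfun]
  exact quadratic_min_le (hP.sum_mul_pos (q22_pos hp ht hn h hex)) y

lemma IsDesign.qmin_le (hp : 2 ≤ p) (ht : 2 ≤ t) (hn : 1 ≤ n) (h : IsWeight p a)
    (hex : ∃ k ∈ Finset.Icc 2 p, 0 < a k) {P : (Fin p → Fin t) → ℝ} (hP : IsDesign P) (x : ℝ) :
    qmin p t n a P ≤ ∑ s, P s * qfun p t n a s x := by
  obtain ⟨y, hy⟩ := hP.exists_isLeast hp ht hn h hex
  exact csInf_le ⟨_, Set.forall_mem_range.2 hy⟩ ⟨x, rfl⟩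

lemma IsDesign.qmin_le_ystar (hp : 2 ≤ p) (ht : 2 ≤ t) (hn : 1 ≤ n) (h : IsWeight p a)
    (hex : ∃ k ∈ Finset.Icc 2 p, 0 < a k) {P : (Fin p → Fin t) → ℝ} (hP : IsDesign P) :
    qmin p t n a P ≤ ystar p t n a := by
  refine le_csSup ⟨∑ s, |qfun p t n a s 0|, ?_⟩ ⟨P, hP, rfl⟩
  rintro _ ⟨Q, hQ, rfl⟩
  refine (hQ.qmin_le hp ht hn h hex 0).trans (Finset.sum_le_sum fun s _ => ?_)
  have hQ1 : Q s ≤ 1 := by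
    rw [← hQ.2]
    exact Finset.single_le_sum (fun s _ => hQ.1 s) (Finset.mem_univ s)
  calc Q s * qfun p t n a s 0 ≤ Q s * |qfun p t n a s 0| :=
        mul_le_mul_of_nonneg_left (le_abs_self _) (hQ.1 s)
    _ ≤ |qfun p t n a s 0| := mul_le_of_le_one_left (abs_nonneg _) hQ1

lemma IsDesign.exists_sum_le_ystar (hp : 2 ≤ p) (ht : 2 ≤ t) (hn : 1 ≤ n) (h : IsWeight p a)
    (hex : ∃ k ∈ Finset.Icc 2 p, 0 < a k) {P : (Fin p → Fin t) → ℝ} (hP : IsDesign P) :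
    ∃ x, ∑ s, P s * qfun p t n a s x ≤ ystar p t n a := by
  obtain ⟨x, hx⟩ := hP.exists_isLeast hp ht hn h hex
  refine ⟨x, le_trans ?_ (hP.qmin_le_ystar hp ht hn h hex)⟩
  exact le_csInf (Set.range_nonempty _) (Set.forall_mem_range.2 hx)

lemma exists_mix_quadratic_pos {C δ : ℝ} (hC : 0 < C) (hδ : 0 < δ) (D : ℝ) {E : ℝ}
    (hE : 0 ≤ E) : ∃ ε ∈ Set.Icc (0 : ℝ) 1,
      ∀ x : ℝ, 0 < (1 - ε) * (C * x ^ 2) + ε * (δ + D * x + E * x ^ 2) := by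
  have hD : 0 < D ^ 2 + 1 := by positivity
  set ε := min (1 / 2) (C * δ / (D ^ 2 + 1)) with hε
  have hε0 : 0 < ε := lt_min (by norm_num) (by positivity)
  have hε1 : ε ≤ 1 / 2 := min_le_left _ _
  have hε2 : ε * (D ^ 2 + 1) ≤ C * δ := (le_div_iff₀ hD).1 (min_le_right _ _)
  refine ⟨ε, ⟨hε0.le, by linarith⟩, fun x => ?_⟩
  have h1 : 0 ≤ (1 / 2 - ε) * (C * x ^ 2) := mul_nonneg (by linarith) (by positivity)
  have h2 : 0 ≤ ε * (E * x ^ 2) := by positivity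
  have h3 := sq_nonneg (C * x + ε * D)
  have h4 : ε * (ε * (D ^ 2 + 1)) ≤ ε * (C * δ) := mul_le_mul_of_nonneg_left hε2 hε0.le
  have h5 : 0 < ε ^ 2 := by positivity
  have h6 : 0 < ε * (C * δ) := by positivity
  have h7 : 0 < C * (1 / 2 * (C * x ^ 2) + ε * δ + ε * (D * x)) := by nlinarith
  have h8 := pos_of_mul_pos_right h7 hC.le
  linarith

lemma qfun_le_ystar (hp : 2 ≤ p) (ht : 2 ≤ t) (hn : 1 ≤ n) (h : IsWeight p a)
    (hex : ∃ k ∈ Finset.Icc 2 p, 0 < a k) {P : (Fin p → Fin t) → ℝ} (hP : IsDesign P)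
    (hmax : qmin p t n a P = ystar p t n a) {x : ℝ}
    (hx : ∑ s, P s * qfun p t n a s x = ystar p t n a) (s : Fin p → Fin t) :
    qfun p t n a s x ≤ ystar p t n a := by
  by_contra! hlt
  set C := ∑ s, P s * q22 p t n a s with hCdef
  have hC : 0 < C := hP.sum_mul_pos (q22_pos hp ht hn h hex)
  have hcrit : ∑ s, P s * q12 p t n a s = -(C * x) := by
    have h1 := (hmax.symm.trans_le (hP.qmin_le hp ht hn h hex
      (-((∑ s, P s * q12 p t n a s) / C))))
    rw [← hx, sum_mul_qfun, sum_mul_qfun, ← hCdef] at h1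
    set B := ∑ s, P s * q12 p t n a s
    have h2 : 2 * B * x + C * x ^ 2 - (2 * B * -(B / C) + C * (-(B / C)) ^ 2)
        = C * (x + B / C) ^ 2 := by
      field_simp
      ring
    have h3 : C * (x + B / C) ^ 2 ≤ 0 := by linarith
    have h4 : (x + B / C) ^ 2 = 0 := by
      have := sq_nonneg (x + B / C)
      by_contra h0
      exact h3.not_gt (mul_pos hC (lt_of_le_of_ne this (Ne.symm h0)))
    have h5 : x + B / C = 0 := by simpa using h4
    field_simp at h5
    linarith
  obtain ⟨ε, hε, hpos⟩ := exists_mix_quadratic_pos hC (sub_pos.2 hlt)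
    (2 * q12 p t n a s + 2 * q22 p t n a s * x) (q22_pos hp ht hn h hex s).le
  have hsingle : IsDesign (Pi.single s 1 : (Fin p → Fin t) → ℝ) := by
    refine ⟨fun r => ?_, by simp⟩
    rw [Pi.single_apply]
    split_ifs <;> norm_num
  obtain ⟨y, hy⟩ := (hP.mix hsingle hε).exists_sum_le_ystar hp ht hn h hex
  have hsum : ∑ r, ((1 - ε) • P + ε • Pi.single s 1 : (Fin p → Fin t) → ℝ) r * qfun p t n a r y
      = (1 - ε) * ∑ r, P r * qfun p t n a r y + ε * qfun p t n a s y := by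
    simp only [Pi.add_apply, Pi.smul_apply, smul_eq_mul, add_mul, Finset.sum_add_distrib,
      mul_assoc, ← Finset.mul_sum]
    simp [Pi.single_apply]
  have hPy : ∑ r, P r * qfun p t n a r y = ystar p t n a + C * (y - x) ^ 2 := by
    rw [← hx, sum_mul_qfun, sum_mul_qfun, hcrit]
    ring
  have hsy : qfun p t n a s y = qfun p t n a s x
      + (2 * q12 p t n a s + 2 * q22 p t n a s * x) * (y - x) + q22 p t n a s * (y - x) ^ 2 := by
    rw [qfun, qfun]
    ring
  rw [hsum, hPy, hsy] at hy
  have := hpos (y - x)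
  linarith

end Minimax

/-- Lemma 3.2: a φ₁-universally optimal design is supported on
`T = {s : q_s(x*) = y*}`, where `x*` is the minimizer of `x ↦ ∑_s p*_s q_s(x)`
for a design `P*` attaining `y*`. -/
theorem univOptimal_support
    (p t n : ℕ) (hp : 2 ≤ p) (ht : 2 ≤ t) (hn : 1 ≤ n)
    (a : ℕ → ℝ) (ha0 : ∀ k ∈ Finset.Icc 1 p, 0 ≤ a k)
    (hsum : ∑ k ∈ Finset.Icc 1 p, a k = 1)
    (hex : ∃ k ∈ Finset.Icc 2 p, 0 < a k)
    (Pstar : (Fin p → Fin t) → ℝ) (hPstar : IsDesign Pstar)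
    (hPmax : qmin p t n a Pstar = ystar p t n a)
    (xstar : ℝ)
    (hxstar : ∑ s, Pstar s * qfun p t n a s xstar = ystar p t n a)
    (P : (Fin p → Fin t) → ℝ) (hP : IsDesign P)
    (hopt : IsUnivOptimal p t n a P) :
    ∀ s : Fin p → Fin t, qfun p t n a s xstar ≠ ystar p t n a → P s = 0 := by
  have h : IsWeight p a := ⟨ha0, hsum⟩
  have hn0 : (0 : ℝ) < n := by positivity
  have hker : ∀ Q : (Fin p → Fin t) → ℝ, IsDesign Q → ∀ u,
      C22 p t n a Q *ᵥ u = 0 → C12 p t n a Q *ᵥ u = 0 := fun Q hQ u hu => hopt.ker_le hQ hu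
  obtain ⟨WP, hWP⟩ := exists_isGInv (C22 p t n a P)
  obtain ⟨WQ, hWQ⟩ := exists_isGInv (C22 p t n a (symmetrize Pstar))
  have hQ := isDesign_symmetrize hPstar
  obtain ⟨x, hx⟩ := (isSymmetricDesign_symmetrize Pstar).exists_trace_CInfo_eq
    hp ht hn h hex hQ hWQ
  rw [sum_symmetrize_mul _ fun σ s => qfun_relabel σ s x] at hx
  have hlow := hPmax.symm.trans_le (hPstar.qmin_le hp ht hn h hex x)
  have hup := trace_CInfo_le ht hn h hP (redC22_quad_nonneg hp hn h ht hex hker hP) (hker P hP)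
    hWP xstar
  have hle : ystar p t n a ≤ ∑ s, P s * qfun p t n a s xstar := by
    refine le_of_mul_le_mul_left ?_ hn0
    refine le_trans (mul_le_mul_of_nonneg_left hlow hn0.le) ?_
    rw [← hx]
    exact (hopt _ isCriterion_trace _ hQ WP WQ hWP hWQ).trans hup
  have hterm : ∀ s ∈ Finset.univ, 0 ≤ P s * (ystar p t n a - qfun p t n a s xstar) :=
    fun s _ => mul_nonneg (hP.1 s)
      (sub_nonneg.2 (qfun_le_ystar hp ht hn h hex hPstar hPmax hxstar s))
  have hzero : ∑ s, P s * (ystar p t n a - qfun p t n a s xstar) = 0 := by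
    refine le_antisymm ?_ (Finset.sum_nonneg hterm)
    simp only [mul_sub, Finset.sum_sub_distrib, ← Finset.sum_mul, hP.2]
    linarith
  intro s hs
  have := (Finset.sum_eq_zero_iff_of_nonneg hterm).1 hzero s (Finset.mem_univ s)
  exact (mul_eq_zero.1 this).resolve_right (sub_ne_zero.2 hs.symm)

end
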